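/- Let H_1,…,H_k be Euclidean spaces with dim H_i = n_i ≥ 1, let B_i : ℝ^n → H_i be surjective linear maps, and let c_1,…,c_k > 0 satisfy ∑_{i=1}^k c_i n_i = n. Then for all non-negative f_i ∈ L^1(H_i), ∫_{ℝ^n} ∏_{i=1}^k f_i(B_i x)^{c_i} dx ≤ C ∏_{i=1}^k (∫_{H_i} f_i)^{c_i}, where C is the smallest constant for which the inequality holds for all centered Gaussian inputs f_i(x) = e^{−⟨A_i x, x⟩} with A_i : H_i → H_i positive definite; that is, C is the supremum over such Gaussians of the ratio of the left-hand side to ∏_{i=1}^k (∫_{H_i} f_i)^{c_i}. -/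

import Mathlib

open MeasureTheory
open scoped ENNReal RealInnerProductSpace

/-- A linear map `A` on a real inner product space is positive definite if it is
self-adjoint and `⟪x, Ax⟫ > 0` for all `x ≠ 0`. -/
def IsPosDefMap {H : Type*} [NormedAddCommGroup H] [InnerProductSpace ℝ H]
    (A : H →ₗ[ℝ] H) : Prop :=
  (∀ x y : H, ⟪A x, y⟫ = ⟪x, A y⟫) ∧ ∀ x : H, x ≠ 0 → 0 < ⟪x, A x⟫

namespace BrascampLieb

open ProbabilityTheory

theorem log_one_add_le_cubic {x : ℝ} (hx : -1 < x) :
    Real.log (1 + x) ≤ x - x ^ 2 / 2 + |x| ^ 3 / 3 := by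
  have hd : ∀ y : ℝ, -1 < y → HasDerivAt
      (fun y : ℝ => y - y ^ 2 / 2 + y ^ 3 / 3 - Real.log (1 + y)) (y ^ 3 / (1 + y)) y := by
    intro y hy
    have hy' : (1 + y) ≠ 0 := by linarith
    have h := (((hasDerivAt_id y).sub (((hasDerivAt_id y).pow 2).div_const 2)).add
      (((hasDerivAt_id y).pow 3).div_const 3)).sub (((hasDerivAt_id y).const_add 1).log hy')
    refine h.congr_deriv ?_
    simp only [id, Nat.cast_ofNat]
    field_simp
    ring
  have h0 : x - x ^ 2 / 2 + x ^ 3 / 3 - Real.log (1 + x) ≥ 0 := by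
    rcases le_total 0 x with h | h
    · have := monotoneOn_of_deriv_nonneg (convex_Ici (0 : ℝ))
        (f := fun y : ℝ => y - y ^ 2 / 2 + y ^ 3 / 3 - Real.log (1 + y))
        (fun y hy => (hd y (by simp at hy; linarith)).continuousAt.continuousWithinAt)
        (fun y hy => (hd y (by simp at hy; linarith)).differentiableAt.differentiableWithinAt)
        (fun y hy => by
          simp at hy
          rw [(hd y (by linarith)).deriv]; positivity)
        (Set.mem_Ici.2 le_rfl) (Set.mem_Ici.2 h) h
      simpa using this
    · have := antitoneOn_of_deriv_nonpos (convex_Ioc (-1 : ℝ) 0)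
        (f := fun y : ℝ => y - y ^ 2 / 2 + y ^ 3 / 3 - Real.log (1 + y))
        (fun y hy => (hd y hy.1).continuousAt.continuousWithinAt)
        (fun y hy => (hd y (interior_subset hy).1).differentiableAt.differentiableWithinAt)
        (fun y hy => by
          have hy' := interior_subset hy
          rw [(hd y hy'.1).deriv]
          exact div_nonpos_of_nonpos_of_nonneg (Odd.pow_nonpos (by decide) hy'.2)
            (by linarith [hy'.1]))
        (Set.mem_Ioc.2 ⟨hx, h⟩) (Set.mem_Ioc.2 ⟨by norm_num, le_rfl⟩) h
      simpa using this
  have h3 : x ^ 3 ≤ |x| ^ 3 := by rw [← abs_pow]; exact le_abs_self _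
  linarith

theorem exp_le_quadratic_add (u : ℝ) :
    Real.exp u ≤ 1 + u + u ^ 2 / 2 + |u| ^ 3 * Real.exp |u| := by
  have h := Complex.norm_exp_sub_sum_le_norm_mul_exp u 3
  have e : Complex.exp u - ∑ m ∈ Finset.range 3, (u : ℂ) ^ m / (m.factorial : ℂ) =
      ((Real.exp u - (1 + u + u ^ 2 / 2) : ℝ) : ℂ) := by
    simp [Finset.sum_range_succ, Nat.factorial]
  rw [e, Complex.norm_real, Complex.norm_real, Real.norm_eq_abs, Real.norm_eq_abs] at h
  linarith [le_abs_self (Real.exp u - (1 + u + u ^ 2 / 2))]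

/-- Second order expansion of a weighted product of numbers close to `1`. -/
theorem exists_exp_sum_log_le {ι : Type*} [Fintype ι] (c : ι → ℝ) (hc : ∀ i, 0 < c i)
    (R : ℝ) (hR : 0 ≤ R) :
    ∃ C : ℝ, 0 ≤ C ∧ ∀ (x l : ι → ℝ) (q : ℝ), (∀ i, -1 < x i) → (∀ i, |x i| ≤ R) →
      (∀ i, |x i| ≤ q) → (∀ i, |l i| ≤ q) → (∀ i, |x i - l i| ≤ q ^ 2) → 0 ≤ q →
      Real.exp (∑ i, c i * Real.log (1 + x i)) ≤
        1 + ∑ i, c i * x i + ((∑ i, c i * l i) ^ 2 - ∑ i, c i * l i ^ 2) / 2 + C * q ^ 3 := by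
  set S := ∑ i, c i with hS
  have hS0 : 0 ≤ S := Finset.sum_nonneg fun i _ => (hc i).le
  set K := S * (1 + R / 2 + R ^ 2 / 3) with hK
  have hK0 : 0 ≤ K := by positivity
  refine ⟨K ^ 3 * Real.exp (K * R) + S * (1 / 2 + R / 3) * (K + S) / 2 + S ^ 2 + S + S / 3,
    by positivity, ?_⟩
  intro x l q hx1 hxR hxq hlq hxl hq
  have bound : ∀ (f : ι → ℝ) (b : ℝ), (∀ i, |f i| ≤ b) → |∑ i, c i * f i| ≤ S * b := by
    intro f b hf
    refine (Finset.abs_sum_le_sum_abs _ _).trans ?_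
    rw [hS, Finset.sum_mul]
    refine Finset.sum_le_sum fun i _ => ?_
    rw [abs_mul, abs_of_pos (hc i)]
    exact mul_le_mul_of_nonneg_left (hf i) (hc i).le
  set a := ∑ i, c i * x i with ha
  set Q := ∑ i, c i * x i ^ 2 with hQ
  set W := ∑ i, c i * (|x i| ^ 3 / 3) with hW
  set lam := ∑ i, c i * l i with hlam
  set Ql := ∑ i, c i * l i ^ 2 with hQl
  have hlog : ∑ i, c i * Real.log (1 + x i) ≤ a - Q / 2 + W := by
    rw [ha, hQ, hW, Finset.sum_div, ← Finset.sum_sub_distrib, ← Finset.sum_add_distrib]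
    refine Finset.sum_le_sum fun i _ => ?_
    have := mul_le_mul_of_nonneg_left (log_one_add_le_cubic (hx1 i)) (hc i).le
    linarith
  have h_aq : |a| ≤ S * q := bound _ _ hxq
  have h_aR : |a| ≤ S * R := bound _ _ hxR
  have h_lam : |lam| ≤ S * q := bound _ _ hlq
  have sq1 : ∀ i, x i ^ 2 ≤ q * q := fun i => by
    rw [← sq_abs, sq]; exact mul_le_mul (hxq i) (hxq i) (abs_nonneg _) hq
  have sq2 : ∀ i, x i ^ 2 ≤ R * q := fun i => by
    rw [← sq_abs, sq]; exact mul_le_mul (hxR i) (hxq i) (abs_nonneg _) hR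
  have sq3 : ∀ i, x i ^ 2 ≤ R * R := fun i => by
    rw [← sq_abs, sq]; exact mul_le_mul (hxR i) (hxR i) (abs_nonneg _) hR
  have asq : ∀ i, |x i ^ 2| = x i ^ 2 := fun i => abs_of_nonneg (sq_nonneg _)
  have h_Q1 : |Q| ≤ S * (q * q) := bound _ _ fun i => (asq i).trans_le (sq1 i)
  have h_Q2 : |Q| ≤ S * (R * q) := bound _ _ fun i => (asq i).trans_le (sq2 i)
  have h_Q3 : |Q| ≤ S * (R * R) := bound _ _ fun i => (asq i).trans_le (sq3 i)
  have cu : ∀ i (b d : ℝ), x i ^ 2 ≤ b → |x i| ≤ d → 0 ≤ b → |(|x i| ^ 3 / 3)| ≤ b * d / 3 := by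
    intro i b d h1 h2 h3
    rw [abs_of_nonneg (by positivity), pow_succ, sq_abs]
    have := mul_le_mul h1 h2 (abs_nonneg _) h3
    linarith
  have h_W1 : |W| ≤ S * (q * q * q / 3) :=
    bound _ _ fun i => cu i _ _ (sq1 i) (hxq i) (by positivity)
  have h_W2 : |W| ≤ S * (R * R * q / 3) :=
    bound _ _ fun i => cu i _ _ (sq3 i) (hxq i) (by positivity)
  have h_W3 : |W| ≤ S * (R * R * R / 3) :=
    bound _ _ fun i => cu i _ _ (sq3 i) (hxR i) (by positivity)
  have h_W4 : |W| ≤ S * (q * q * R / 3) :=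
    bound _ _ fun i => cu i _ _ (sq1 i) (hxR i) (by positivity)
  have h_QQ : |Q - Ql| ≤ S * (q ^ 2 * (2 * q)) := by
    have : Q - Ql = ∑ i, c i * ((x i - l i) * (x i + l i)) := by
      rw [hQ, hQl, ← Finset.sum_sub_distrib]
      exact Finset.sum_congr rfl fun i _ => by ring
    rw [this]
    refine bound _ _ fun i => ?_
    rw [abs_mul]
    refine mul_le_mul (hxl i) ((abs_add_le _ _).trans ?_) (abs_nonneg _) (by positivity)
    linarith [hxq i, hlq i]
  have h_al : |a - lam| ≤ S * q ^ 2 := by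
    have : a - lam = ∑ i, c i * (x i - l i) := by
      rw [ha, hlam, ← Finset.sum_sub_distrib]
      exact Finset.sum_congr rfl fun i _ => by ring
    rw [this]
    exact bound _ _ hxl
  have h_al2 : |a ^ 2 - lam ^ 2| ≤ S * q ^ 2 * (2 * S * q) := by
    have : a ^ 2 - lam ^ 2 = (a - lam) * (a + lam) := by ring
    rw [this, abs_mul]
    refine mul_le_mul h_al ((abs_add_le _ _).trans (by linarith)) (abs_nonneg _) (by positivity)
  obtain ⟨u, hu⟩ : ∃ u, u = a - Q / 2 + W := ⟨_, rfl⟩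
  have tri : |u| ≤ |a| + |Q| / 2 + |W| := by
    rw [hu]
    refine (abs_add_le _ _).trans ?_
    have := abs_sub a (Q / 2)
    rw [abs_div, abs_two] at this
    linarith
  have h_uq : |u| ≤ K * q := by rw [hK]; linarith
  have h_uR : |u| ≤ K * R := by rw [hK]; linarith
  have h_ua : |u - a| ≤ S * (1 / 2 + R / 3) * q ^ 2 := by
    have : u - a = W - Q / 2 := by rw [hu]; ring
    rw [this]
    have := abs_sub W (Q / 2)
    rw [abs_div, abs_two] at this
    linarith
  have h_ua2 : |u ^ 2 - a ^ 2| ≤ S * (1 / 2 + R / 3) * q ^ 2 * ((K + S) * q) := by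
    have : u ^ 2 - a ^ 2 = (u - a) * (u + a) := by ring
    rw [this, abs_mul]
    exact mul_le_mul h_ua ((abs_add_le _ _).trans (by linarith)) (abs_nonneg _) (by positivity)
  have h_exp : |u| ^ 3 * Real.exp |u| ≤ (K * q) ^ 3 * Real.exp (K * R) := by gcongr
  calc Real.exp (∑ i, c i * Real.log (1 + x i)) ≤ Real.exp u := Real.exp_le_exp.2 (hu ▸ hlog)
    _ ≤ 1 + u + u ^ 2 / 2 + |u| ^ 3 * Real.exp |u| := exp_le_quadratic_add u
    _ ≤ _ := by
      have e1 := le_abs_self (u ^ 2 - a ^ 2)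
      have e2 := le_abs_self (a ^ 2 - lam ^ 2)
      have e3 := neg_abs_le (Q - Ql)
      have e4 := le_abs_self W
      linarith [h_ua2, h_al2, h_QQ, h_W1, h_exp, hu]

/-- Measurable functions with values in `[ε, M]` which admit a first order expansion at every
point, with gradient bounded by `M` and a remainder that is at most `M` times the square of the
increment. -/
structure IsTame {H : Type*} [NormedAddCommGroup H] [InnerProductSpace ℝ H] [MeasurableSpace H]
    (ε M : ℝ) (g : H → ℝ) : Prop where
  measurable : Measurable g
  lower : ∀ y, ε ≤ g y
  upper : ∀ y, g y ≤ M
  expansion : ∃ v : H → H, Measurable v ∧ (∀ y, ‖v y‖ ≤ M) ∧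
    ∀ y h, |g (y + h) - g y - ⟪v y, h⟫| ≤ M * ‖h‖ ^ 2

section Tame

variable {H : Type*} [NormedAddCommGroup H] [InnerProductSpace ℝ H] [MeasurableSpace H]

theorem IsTame.abs_le {ε M : ℝ} {g : H → ℝ} (hg : IsTame ε M g) (hε : 0 ≤ ε) (y : H) :
    |g y| ≤ M := by
  rw [abs_of_nonneg (hε.trans (hg.lower y))]; exact hg.upper y

theorem IsTame.add_const {ε M : ℝ} {g : H → ℝ} (hg : IsTame ε M g) {a : ℝ} (ha : 0 ≤ a) :
    IsTame (ε + a) (M + a) (fun y => g y + a) := by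
  obtain ⟨v, hv, hvM, hexp⟩ := hg.expansion
  refine ⟨hg.measurable.add_const a, fun y => by linarith [hg.lower y],
    fun y => by linarith [hg.upper y], v, hv, fun y => (hvM y).trans (by linarith), fun y h => ?_⟩
  have := hexp y h
  rw [show g (y + h) + a - (g y + a) - ⟪v y, h⟫ = g (y + h) - g y - ⟪v y, h⟫ by ring]
  nlinarith [sq_nonneg ‖h‖]

theorem IsTame.integrable_comp {ε M : ℝ} {g : H → ℝ} (hg : IsTame ε M g) (hε : 0 ≤ ε)
    {Ω : Type*} [MeasurableSpace Ω] {μ : Measure Ω} [IsFiniteMeasure μ] {τ : Ω → H}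
    (hτ : Measurable τ) : Integrable (fun ω => g (τ ω)) μ :=
  Integrable.of_bound (hg.measurable.comp hτ).aestronglyMeasurable M
    (Filter.Eventually.of_forall fun ω => hg.abs_le hε (τ ω))

variable [FiniteDimensional ℝ H] [BorelSpace H]

theorem IsTame.average {ε M : ℝ} {g : H → ℝ} (hg : IsTame ε M g) (hε : 0 ≤ ε)
    {Ω : Type*} [MeasurableSpace Ω] (μ : Measure Ω) [IsFiniteMeasure μ] {τ : Ω → H}
    (hτ : Measurable τ) :
    IsTame (ε * μ.real Set.univ) (M * μ.real Set.univ) (fun y => ∫ ω, g (y + τ ω) ∂μ) := by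
  obtain ⟨v, hv, hvM, hexp⟩ := hg.expansion
  have hInt : ∀ y, Integrable (fun ω => g (y + τ ω)) μ := fun y =>
    hg.integrable_comp hε (measurable_const.add hτ)
  have hintv : ∀ y, Integrable (fun ω => v (y + τ ω)) μ := fun y =>
    Integrable.of_bound (hv.comp (measurable_const.add hτ)).aestronglyMeasurable M
      (Filter.Eventually.of_forall fun ω => hvM _)
  refine ⟨?_, fun y => ?_, fun y => ?_, fun y => ∫ ω, v (y + τ ω) ∂μ, ?_, fun y => ?_,
    fun y h => ?_⟩
  · have : StronglyMeasurable (fun p : H × Ω => g (p.1 + τ p.2)) :=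
      (hg.measurable.comp (measurable_fst.add (hτ.comp measurable_snd))).stronglyMeasurable
    exact this.integral_prod_right.measurable
  · calc ε * μ.real Set.univ = ∫ _, ε ∂μ := by simp [mul_comm]
      _ ≤ _ := integral_mono (integrable_const _) (hInt y) fun ω => hg.lower _
  · calc _ ≤ ∫ _, M ∂μ := integral_mono (hInt y) (integrable_const _) fun ω => hg.upper _
      _ = M * μ.real Set.univ := by simp [mul_comm]
  · have : StronglyMeasurable (fun p : H × Ω => v (p.1 + τ p.2)) :=
      (hv.comp (measurable_fst.add (hτ.comp measurable_snd))).stronglyMeasurable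
    exact this.integral_prod_right.measurable
  · exact norm_integral_le_of_norm_le_const (Filter.Eventually.of_forall fun ω => hvM _)
  · have e : (∫ ω, g (y + h + τ ω) ∂μ) - (∫ ω, g (y + τ ω) ∂μ) - ⟪∫ ω, v (y + τ ω) ∂μ, h⟫ =
        ∫ ω, (g (y + τ ω + h) - g (y + τ ω) - ⟪v (y + τ ω), h⟫) ∂μ := by
      have hi : Integrable (fun ω => ⟪v (y + τ ω), h⟫) μ := (hintv y).inner_const h
      have h1 : Integrable (fun ω => g (y + τ ω + h)) μ := by
        simpa [add_right_comm] using hInt (y + h)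
      rw [integral_sub (f := fun ω => g (y + τ ω + h) - g (y + τ ω)) (h1.sub (hInt y)) hi,
        integral_sub h1 (hInt y)]
      congr 1
      · simp [add_right_comm]
      · rw [real_inner_comm, ← integral_inner (hintv y)]
        simp [real_inner_comm]
    rw [e]
    have := norm_integral_le_of_norm_le_const (μ := μ)
      (Filter.Eventually.of_forall fun ω => (Real.norm_eq_abs _).trans_le (hexp (y + τ ω) h))
    rw [Real.norm_eq_abs] at this
    linarith

theorem exists_isTame_of_contDiff {g : H → ℝ} (hg : ContDiff ℝ 2 g) (hc : HasCompactSupport g)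
    (h0 : ∀ y, 0 ≤ g y) : ∃ M, IsTame 0 M g := by
  obtain ⟨C₁, hC₁⟩ := hg.continuous.bounded_above_of_compact_support hc
  have hg' : ContDiff ℝ 1 (fderiv ℝ g) := hg.fderiv_right (by norm_num)
  obtain ⟨C₂, hC₂⟩ := hg'.continuous.bounded_above_of_compact_support (hc.fderiv ℝ)
  obtain ⟨C₃, hC₃⟩ := hg'.lipschitzWith_of_hasCompactSupport (hc.fderiv ℝ) (by norm_num)
  have hdiff : Differentiable ℝ g := hg.differentiable (by norm_num)
  set M := max (max C₁ C₂) C₃ with hM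
  have h1 : C₁ ≤ M := (le_max_left _ _).trans (le_max_left _ _)
  have h2 : C₂ ≤ M := (le_max_right _ _).trans (le_max_left _ _)
  have h3 : (C₃ : ℝ) ≤ M := le_max_right _ _
  refine ⟨M, hg.continuous.measurable, h0, fun y => (le_abs_self _).trans ((hC₁ y).trans h1),
    fun y => (InnerProductSpace.toDual ℝ H).symm (fderiv ℝ g y), ?_, fun y => ?_, fun y h => ?_⟩
  · exact ((InnerProductSpace.toDual ℝ H).symm.continuous.comp hg'.continuous).measurable
  · rw [LinearIsometryEquiv.norm_map]; exact (hC₂ y).trans h2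
  · rw [InnerProductSpace.toDual_symm_apply]
    have key := (convex_segment y (y + h)).norm_image_sub_le_of_norm_hasFDerivWithin_le'
      (f := g) (f' := fderiv ℝ g) (φ := fderiv ℝ g y) (C := M * ‖h‖)
      (fun z _ => (hdiff z).hasFDerivAt.hasFDerivWithinAt) (fun z hz => by
        rw [← dist_eq_norm]
        refine (hC₃.dist_le_mul z y).trans ?_
        refine mul_le_mul h3 ?_ dist_nonneg ((NNReal.coe_nonneg _).trans h3)
        have := mem_segment_iff_wbtw.1 hz
        have := this.dist_add_dist
        rw [dist_comm z y]
        have e : dist y (y + h) = ‖h‖ := by simp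
        linarith [dist_nonneg (x := z) (y := y + h)])
      (left_mem_segment ℝ y (y + h)) (right_mem_segment ℝ y (y + h))
    simp only [add_sub_cancel_left] at key
    rw [Real.norm_eq_abs] at key
    linarith [key]

theorem IsTame.exists_convolution {M : ℝ} {φ f : H → ℝ} (hφ : IsTame 0 M φ)
    (hf : Integrable f) (hf0 : ∀ y, 0 ≤ f y) :
    ∃ M', IsTame 0 M' (fun y => ∫ t, f t * φ (y - t)) := by
  set μ : Measure H := volume.withDensity fun t => ENNReal.ofReal (f t) with hμ
  have : IsFiniteMeasure μ := isFiniteMeasure_withDensity_ofReal hf.hasFiniteIntegral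
  have h := hφ.average le_rfl μ (τ := fun t => -t) measurable_neg
  rw [zero_mul] at h
  refine ⟨M * μ.real Set.univ, ?_⟩
  · convert h using 2 with y
    rw [hμ, integral_withDensity_eq_integral_toReal_smul₀ hf.aemeasurable.ennreal_ofReal
      (Filter.Eventually.of_forall fun _ => ENNReal.ofReal_lt_top)]
    simp [ENNReal.toReal_ofReal (hf0 _), sub_eq_add_neg]

end Tame

/-- Integrable non-negative functions are limits, almost everywhere, of tame functions with the
same integral. -/
theorem exists_isTame_seq {H : Type*} [NormedAddCommGroup H] [InnerProductSpace ℝ H]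
    [FiniteDimensional ℝ H] [MeasurableSpace H] [BorelSpace H] {f : H → ℝ}
    (hf : Integrable f) (hf0 : ∀ y, 0 ≤ f y) :
    ∃ g : ℕ → H → ℝ, (∀ m, ∃ M, IsTame 0 M (g m)) ∧ (∀ m, Integrable (g m)) ∧
      (∀ m, ∫ y, g m y = ∫ y, f y) ∧
      ∀ᵐ y, Filter.Tendsto (fun m => g m y) Filter.atTop (nhds (f y)) := by
  let φ : ℕ → ContDiffBump (0 : H) := fun m =>
    ⟨1 / (m + 1), 2 / (m + 1), by positivity, by gcongr; norm_num⟩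
  have hlim : Filter.Tendsto (fun m => (φ m).rOut) Filter.atTop (nhds 0) := by
    have := (tendsto_one_div_add_atTop_nhds_zero_nat (𝕜 := ℝ)).const_mul 2
    simpa [φ, div_eq_mul_inv] using this
  have hae := ContDiffBump.ae_convolution_tendsto_right_of_locallyIntegrable (μ := volume)
    (φ := φ) (K := 2) hlim (Filter.Eventually.of_forall fun m => by simp [φ]; ring_nf; rfl)
    hf.locallyIntegrable
  have hφint : ∀ m, Integrable ((φ m).normed volume) := fun m => (φ m).integrable_normed
  have e : ∀ m, (fun y => ∫ t, f t * (φ m).normed volume (y - t)) =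
      convolution ((φ m).normed volume) f (ContinuousLinearMap.lsmul ℝ ℝ) volume := by
    intro m; ext y
    rw [convolution_eq_swap]
    simp [mul_comm]
  refine ⟨fun m y => ∫ t, f t * (φ m).normed volume (y - t), fun m => ?_, fun m => ?_,
    fun m => ?_, ?_⟩
  · obtain ⟨M, hM⟩ := exists_isTame_of_contDiff ((φ m).contDiff_normed (μ := volume) (n := 2))
      ((φ m).hasCompactSupport_normed) (fun y => (φ m).nonneg_normed y)
    exact hM.exists_convolution hf hf0
  · simp only [e]; exact (hφint m).integrable_convolution _ hf
  · simp only [e]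
    rw [integral_convolution _ (hφint m) hf, (φ m).integral_normed]; simp
  · simpa only [← e] using hae

section Gaussian

variable {E : Type*} [NormedAddCommGroup E] [InnerProductSpace ℝ E] [FiniteDimensional ℝ E]
  [MeasurableSpace E] [BorelSpace E]

theorem integrable_one_add_norm_sq_pow (p : ℕ) :
    Integrable (fun z : E => (1 + ‖z‖ ^ 2) ^ p) (stdGaussian E) := by
  have h := IsGaussian.memLp_id (stdGaussian E) ((2 * p : ℕ) : ℝ≥0∞) (ENNReal.natCast_ne_top _)
  have h1 : Integrable (fun z : E => ‖z‖ ^ (2 * p)) (stdGaussian E) := by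
    rcases Nat.eq_zero_or_pos p with rfl | hp
    · simp
    · simpa using h.integrable_norm_pow (by omega)
  refine (((integrable_const (1 : ℝ)).add h1).const_mul (2 ^ p)).mono' (by fun_prop)
    (Filter.Eventually.of_forall fun z => ?_)
  rw [Real.norm_of_nonneg (by positivity)]
  have := add_pow_le (zero_le_one (α := ℝ)) (sq_nonneg ‖z‖) p
  refine this.trans ?_
  rw [one_pow, ← pow_mul]
  refine mul_le_mul (pow_le_pow_right₀ (by norm_num) (by omega)) le_rfl (by positivity)
    (by positivity)

theorem integral_inner_stdGaussian (a : E) : ∫ z, ⟪a, z⟫ ∂(stdGaussian E) = 0 := by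
  have := integral_strongDual_stdGaussian (innerSL ℝ a)
  simpa using this

theorem integrable_inner_stdGaussian (a : E) :
    Integrable (fun z => ⟪a, z⟫) (stdGaussian E) :=
  (IsGaussian.integrable_id (μ := stdGaussian E)).const_inner a

theorem integral_inner_sq_stdGaussian (a : E) :
    ∫ z, ⟪a, z⟫ ^ 2 ∂(stdGaussian E) = ‖a‖ ^ 2 := by
  have h := covarianceBilin_apply (IsGaussian.memLp_id (stdGaussian E) 2 (by simp)) a a
  rw [covarianceBilin_stdGaussian] at h
  simp only [id, integral_id_stdGaussian, sub_zero] at h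
  rw [innerSL_apply_apply, real_inner_self_eq_norm_sq] at h
  simp only [h, sq]

theorem integrable_inner_sq_stdGaussian (a : E) :
    Integrable (fun z => ⟪a, z⟫ ^ 2) (stdGaussian E) := by
  refine ((integrable_one_add_norm_sq_pow (E := E) 1).const_mul (‖a‖ ^ 2)).mono'
    (by fun_prop) (Filter.Eventually.of_forall fun z => ?_)
  rw [Real.norm_of_nonneg (sq_nonneg _), ← sq_abs]
  calc |⟪a, z⟫| ^ 2 ≤ (‖a‖ * ‖z‖) ^ 2 := by gcongr; exact abs_real_inner_le_norm a z
    _ ≤ _ := by nlinarith [sq_nonneg ‖a‖]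

theorem map_add_prod_stdGaussian :
    ((stdGaussian E).prod (stdGaussian E)).map (fun p => p.1 + p.2) =
      (stdGaussian E).map (fun z => √2 • z) := by
  have e : ((stdGaussian E).prod (stdGaussian E)).map (fun p => p.1 + p.2) =
      (stdGaussian E) ∗ (stdGaussian E) := rfl
  have : IsFiniteMeasure ((stdGaussian E).map (fun z => √2 • z)) :=
    Measure.isFiniteMeasure_map _ _
  rw [e]
  refine Measure.ext_of_charFun ?_
  ext t
  rw [charFun_conv, charFun_map_smul, charFun_stdGaussian, charFun_stdGaussian, ← Complex.exp_add,
    norm_smul, Real.norm_of_nonneg (Real.sqrt_nonneg 2)]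
  congr 1
  rw [Complex.ofReal_mul, mul_pow, ← Complex.ofReal_pow √2, Real.sq_sqrt (by norm_num)]
  push_cast; ring

theorem integral_sqrt_two_smul_stdGaussian {F : E → ℝ} (hF : Measurable F) {M : ℝ}
    (hM : ∀ z, |F z| ≤ M) :
    ∫ z, F (√2 • z) ∂(stdGaussian E) =
      ∫ z, ∫ z', F (z + z') ∂(stdGaussian E) ∂(stdGaussian E) := by
  rw [← integral_map (φ := fun z : E => √2 • z) (by fun_prop) hF.aestronglyMeasurable,
    ← map_add_prod_stdGaussian, integral_map (by fun_prop) hF.aestronglyMeasurable,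
    integral_prod]
  exact Integrable.of_bound (hF.comp (measurable_fst.add measurable_snd)).aestronglyMeasurable M
    (Filter.Eventually.of_forall fun z => hM _)

end Gaussian

theorem prod_rpow_mem_Icc {ι : Type*} [Fintype ι] {c : ι → ℝ} (hc : ∀ i, 0 < c i) {M : ℝ}
    {y : ι → ℝ} (h0 : ∀ i, 0 ≤ y i) (hM : ∀ i, y i ≤ M) :
    0 ≤ ∏ i, y i ^ c i ∧ ∏ i, y i ^ c i ≤ ∏ i, M ^ c i :=
  ⟨Finset.prod_nonneg fun i _ => Real.rpow_nonneg (h0 i) _,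
    Finset.prod_le_prod (fun i _ => Real.rpow_nonneg (h0 i) _)
      fun i _ => Real.rpow_le_rpow (h0 i) (hM i) (hc i).le⟩

theorem exists_prod_rpow_le {ι : Type*} [Fintype ι] (c : ι → ℝ) (hc : ∀ i, 0 < c i) {ε M : ℝ}
    (hε : 0 < ε) (hM : 0 < M) :
    ∃ C : ℝ, 0 ≤ C ∧ ∀ (a b r P : ℝ) (m g d : ι → ℝ), 0 ≤ a → 0 ≤ b → 0 ≤ r → r ≤ 1 → 1 ≤ P →
      (∀ i, ε ≤ m i) → (∀ i, m i ≤ M) → (∀ i, ε ≤ g i) → (∀ i, g i ≤ M) →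
      (∀ i, |d i| ≤ a * (r * P)) → (∀ i, |g i - m i - d i| ≤ b * (r ^ 2 * P)) →
      ∏ i, g i ^ c i ≤ (∏ i, m i ^ c i) * (1 + ∑ i, c i * (g i / m i - 1) +
        ((∑ i, c i * (d i / m i)) ^ 2 - ∑ i, c i * (d i / m i) ^ 2) / 2 +
        C * (1 + a / ε + b / ε) ^ 3 * r ^ 3 * P ^ 3) := by
  obtain ⟨C, hC0, hC⟩ := exists_exp_sum_log_le c hc (M / ε) (by positivity)
  refine ⟨C, hC0, fun a b r P m g d ha hb hr0 hr1 hP hmε hmM hgε hgM hd hgm => ?_⟩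
  have hm0 : ∀ i, 0 < m i := fun i => hε.trans_le (hmε i)
  have hg0 : ∀ i, 0 < g i := fun i => hε.trans_le (hgε i)
  have hdiv : ∀ i (u v : ℝ), |u| ≤ v → |u / m i| ≤ v / ε := fun i u v h => by
    rw [abs_div, abs_of_pos (hm0 i)]
    exact div_le_div₀ ((abs_nonneg _).trans h) h hε (hmε i)
  have e1 : ∏ i, g i ^ c i =
      (∏ i, m i ^ c i) * Real.exp (∑ i, c i * Real.log (1 + (g i / m i - 1))) := by
    rw [Real.exp_sum, ← Finset.prod_mul_distrib]
    refine Finset.prod_congr rfl fun i _ => ?_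
    rw [add_sub_cancel, mul_comm (c i), ← Real.rpow_def_of_pos (div_pos (hg0 i) (hm0 i)),
      ← Real.mul_rpow (hm0 i).le (div_pos (hg0 i) (hm0 i)).le,
      mul_div_cancel₀ _ (hm0 i).ne']
  rw [e1]
  refine mul_le_mul_of_nonneg_left ?_
    (Finset.prod_nonneg fun i _ => Real.rpow_nonneg (hm0 i).le _)
  have ha' : 0 ≤ a / ε := by positivity
  have hb' : 0 ≤ b / ε := by positivity
  set A := 1 + a / ε + b / ε with hA
  have hA1 : 1 ≤ A := by linarith
  have hP0 : 0 ≤ r * P := by positivity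
  have hrr : r ^ 2 * P ≤ r * P := by
    gcongr; nlinarith
  have hrr2 : r ^ 2 * P ≤ (r * P) ^ 2 := by
    rw [mul_pow]; gcongr; nlinarith
  have hl : ∀ i, |d i / m i| ≤ a / ε * (r * P) := fun i => by
    refine (hdiv i _ _ (hd i)).trans_eq (by ring)
  have hxl : ∀ i, |g i / m i - 1 - d i / m i| ≤ b / ε * (r ^ 2 * P) := fun i => by
    have e : g i / m i - 1 - d i / m i = (g i - m i - d i) / m i := by
      rw [sub_div, sub_div, div_self (hm0 i).ne']
    rw [e]
    refine (hdiv i _ _ (hgm i)).trans_eq (by ring)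
  have hAq : A * (r * P) = r * P + a / ε * (r * P) + b / ε * (r * P) := by rw [hA]; ring
  have b1 : 0 ≤ b / ε * (r * P) := by positivity
  have a1 : 0 ≤ a / ε * (r * P) := by positivity
  have b2 : b / ε * (r ^ 2 * P) ≤ b / ε * (r * P) := mul_le_mul_of_nonneg_left hrr hb'
  have key := hC (fun i => g i / m i - 1) (fun i => d i / m i) (A * (r * P)) (fun i => ?_)
    (fun i => ?_) (fun i => ?_) (fun i => ?_) (fun i => ?_) (by positivity)
  · refine key.trans (le_of_eq ?_)
    ring
  · have : 0 < g i / m i := div_pos (hg0 i) (hm0 i)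
    show -1 < g i / m i - 1
    linarith
  · have : g i / m i - 1 = (g i - m i) / m i := by
      rw [sub_div, div_self (hm0 i).ne']
    show |g i / m i - 1| ≤ _
    rw [this]
    refine hdiv i _ _ (abs_le.2 ⟨?_, ?_⟩)
    · linarith [hg0 i, hmM i]
    · linarith [hm0 i, hgM i]
  · have h1 := abs_add_le (g i / m i - 1 - d i / m i) (d i / m i)
    rw [sub_add_cancel] at h1
    show |g i / m i - 1| ≤ _
    linarith [hxl i, hl i]
  · show |d i / m i| ≤ _
    linarith [hl i]
  · refine (hxl i).trans ?_
    calc _ ≤ A * (r * P) ^ 2 := by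
          refine mul_le_mul ?_ hrr2 (by positivity) (by positivity)
          linarith
      _ ≤ A ^ 2 * (r * P) ^ 2 := by gcongr; nlinarith
      _ = _ := by ring

section OneStep

variable {ι : Type*} [Fintype ι] {E : Type*} [NormedAddCommGroup E] [InnerProductSpace ℝ E]
  [FiniteDimensional ℝ E] [MeasurableSpace E] [BorelSpace E] {H : ι → Type*}
  [∀ i, NormedAddCommGroup (H i)] [∀ i, InnerProductSpace ℝ (H i)]
  [∀ i, FiniteDimensional ℝ (H i)] [∀ i, MeasurableSpace (H i)] [∀ i, BorelSpace (H i)]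

set_option maxHeartbeats 1000000 in
/-- The Gaussian Brascamp--Lieb inequality at small scale, up to a third order error. -/
theorem exists_integral_prod_smul_le (c : ι → ℝ) (hc : ∀ i, 0 < c i) (T : ∀ i, E →L[ℝ] H i)
    (hT : ∀ w : ∀ i, H i, ‖∑ i, c i • (T i).adjoint (w i)‖ ^ 2 ≤
      ∑ i, c i * ‖(T i).adjoint (w i)‖ ^ 2) {ε M : ℝ} (hε : 0 < ε) (hM : 0 < M) :
    ∃ C : ℝ, 0 ≤ C ∧ ∀ r : ℝ, 0 ≤ r → r ≤ 1 → ∀ g : ∀ i, H i → ℝ, (∀ i, IsTame ε M (g i)) →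
      ∫ z, ∏ i, g i (r • T i z) ^ c i ∂(stdGaussian E) ≤
        (1 + C * r ^ 3) * ∏ i, (∫ z, g i (r • T i z) ∂(stdGaussian E)) ^ c i := by
  set γ := stdGaussian E with hγ
  obtain ⟨C, hC0, hC⟩ := exists_prod_rpow_le c hc hε hM
  set I₁ := ∫ z : E, (1 + ‖z‖ ^ 2) ∂γ with hI₁
  set I₃ := ∫ z : E, (1 + ‖z‖ ^ 2) ^ 3 ∂γ with hI₃
  have int1 : Integrable (fun z : E => 1 + ‖z‖ ^ 2) γ := by
    simpa using integrable_one_add_norm_sq_pow (E := E) 1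
  have int3 : Integrable (fun z : E => (1 + ‖z‖ ^ 2) ^ 3) γ := integrable_one_add_norm_sq_pow 3
  have hI₁1 : 1 ≤ I₁ := by
    calc (1 : ℝ) = ∫ z : E, 1 ∂γ := by simp
      _ ≤ _ := integral_mono (integrable_const _) int1 fun z => by
        have := sq_nonneg ‖z‖
        simp only; linarith
  have hI₃0 : 0 ≤ I₃ := integral_nonneg fun z => by positivity
  set N := 1 + ∑ i, ‖T i‖ with hN
  have hTN : ∀ i, ‖T i‖ ≤ N := fun i => by
    have := Finset.single_le_sum (f := fun i => ‖T i‖) (fun j _ => norm_nonneg _)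
      (Finset.mem_univ i)
    linarith
  have hN0 : 0 < N := by
    have : 0 ≤ ∑ i, ‖T i‖ := Finset.sum_nonneg fun j _ => norm_nonneg _
    linarith
  set A := 1 + M * N / ε + 2 * M * N ^ 2 * I₁ / ε with hA
  have hA1 : 1 ≤ A := by
    have h1 : 0 ≤ M * N / ε := by positivity
    have h2 : 0 ≤ 2 * M * N ^ 2 * I₁ / ε := by positivity
    linarith
  refine ⟨C * A ^ 3 * I₃, by positivity, fun r hr0 hr1 g hg => ?_⟩
  choose v hv hvM hexp using fun i => (hg i).expansion
  have hgi : ∀ i, Integrable (fun z : E => g i (r • T i z)) γ := fun i =>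
    (hg i).integrable_comp hε.le (by fun_prop)
  set m : ι → ℝ := fun i => ∫ z, g i (r • T i z) ∂γ with hm
  have hmε : ∀ i, ε ≤ m i := fun i => by
    calc ε = ∫ z : E, ε ∂γ := by simp
      _ ≤ _ := integral_mono (integrable_const _) (hgi i) fun z => (hg i).lower _
  have hm0 : ∀ i, 0 < m i := fun i => hε.trans_le (hmε i)
  have hmM : ∀ i, m i ≤ M := fun i => by
    calc m i ≤ ∫ z : E, M ∂γ :=
          integral_mono (hgi i) (integrable_const _) fun z => (hg i).upper _
      _ = M := by simp
  set w : ∀ i, H i := fun i => (r / m i) • v i 0 with hw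
  set x : E → ι → ℝ := fun z i => g i (r • T i z) / m i - 1 with hx
  set l : E → ι → ℝ := fun z i => ⟪(T i).adjoint (w i), z⟫ with hl
  have hl' : ∀ z i, l z i = ⟪v i 0, r • T i z⟫ / m i := fun z i => by
    simp only [hl, hw, ContinuousLinearMap.adjoint_inner_left, inner_smul_left, inner_smul_right]
    simp; ring
  have hnorm : ∀ z i, ‖r • T i z‖ ≤ r * (N * ‖z‖) := fun z i => by
    rw [norm_smul, Real.norm_of_nonneg hr0]
    gcongr
    exact ((T i).le_opNorm z).trans (by gcongr; exact hTN i)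
  have hrem : ∀ z i, |g i (r • T i z) - g i 0 - ⟪v i 0, r • T i z⟫| ≤
      M * N ^ 2 * r ^ 2 * (1 + ‖z‖ ^ 2) := fun z i => by
    have h1 := hexp i 0 (r • T i z)
    rw [zero_add] at h1
    refine h1.trans ?_
    calc M * ‖r • T i z‖ ^ 2 ≤ M * (r * (N * ‖z‖)) ^ 2 := by gcongr; exact hnorm z i
      _ = M * N ^ 2 * r ^ 2 * ‖z‖ ^ 2 := by ring
      _ ≤ _ := by gcongr; linarith
  have hinner : ∀ i, Integrable (fun z => ⟪v i 0, r • T i z⟫) γ := fun i => by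
    have := (integrable_inner_stdGaussian ((T i).adjoint (w i))).mul_const (m i)
    refine this.congr (Filter.Eventually.of_forall fun z => ?_)
    have := hl' z i
    simp only [hl] at this
    simp only [this]
    field_simp [(hm0 i).ne']
  have hinner0 : ∀ i, ∫ z, ⟪v i 0, r • T i z⟫ ∂γ = 0 := fun i => by
    have h1 : ∀ z, ⟪v i 0, r • T i z⟫ = ⟪r • (T i).adjoint (v i 0), z⟫ := fun z => by
      simp [inner_smul_left, inner_smul_right, ContinuousLinearMap.adjoint_inner_left]
    simp only [h1]
    exact integral_inner_stdGaussian _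
  have hm_g : ∀ i, |m i - g i 0| ≤ M * N ^ 2 * r ^ 2 * I₁ := fun i => by
    have e : m i - g i 0 = ∫ z, (g i (r • T i z) - g i 0 - ⟪v i 0, r • T i z⟫) ∂γ := by
      rw [integral_sub (f := fun z => g i (r • T i z) - g i 0)
        ((hgi i).sub (integrable_const _)) (hinner i), hinner0,
        integral_sub (hgi i) (integrable_const _)]
      simp [hm]
    rw [e, ← Real.norm_eq_abs, hI₁, ← integral_const_mul]
    exact norm_integral_le_of_norm_le (int1.const_mul _)
      (Filter.Eventually.of_forall fun z => hrem z i)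
  have hxl : ∀ z i, |g i (r • T i z) - m i - ⟪v i 0, r • T i z⟫| ≤
      2 * M * N ^ 2 * I₁ * (r ^ 2 * (1 + ‖z‖ ^ 2)) := by
    intro z i
    have e : g i (r • T i z) - m i - ⟪v i 0, r • T i z⟫ =
        (g i (r • T i z) - g i 0 - ⟪v i 0, r • T i z⟫) - (m i - g i 0) := by ring
    rw [e]
    refine ((abs_sub _ _).trans (add_le_add (hrem z i) (hm_g i))).trans ?_
    have hz := sq_nonneg ‖z‖
    have h2 : (1 + ‖z‖ ^ 2) + I₁ ≤ 2 * I₁ * (1 + ‖z‖ ^ 2) := by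
      have := mul_nonneg (sub_nonneg.2 hI₁1) hz
      linarith
    calc M * N ^ 2 * r ^ 2 * (1 + ‖z‖ ^ 2) + M * N ^ 2 * r ^ 2 * I₁
        = M * N ^ 2 * r ^ 2 * ((1 + ‖z‖ ^ 2) + I₁) := by ring
      _ ≤ M * N ^ 2 * r ^ 2 * (2 * I₁ * (1 + ‖z‖ ^ 2)) := by gcongr
      _ = _ := by ring
  have hzP : ∀ z : E, ‖z‖ ≤ 1 + ‖z‖ ^ 2 := fun z => by nlinarith [sq_nonneg (‖z‖ - 1)]
  have hlb : ∀ z i, |⟪v i 0, r • T i z⟫| ≤ M * N * (r * (1 + ‖z‖ ^ 2)) := by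
    intro z i
    calc |⟪v i 0, r • T i z⟫| ≤ ‖v i 0‖ * ‖r • T i z‖ := abs_real_inner_le_norm _ _
      _ ≤ M * (r * (N * (1 + ‖z‖ ^ 2))) := by
        gcongr
        · exact hvM i 0
        · exact (hnorm z i).trans (by gcongr; exact hzP z)
      _ = _ := by ring
  have hpt : ∀ z, ∏ i, g i (r • T i z) ^ c i ≤ (∏ i, m i ^ c i) *
      (1 + ∑ i, c i * x z i + ((∑ i, c i * l z i) ^ 2 - ∑ i, c i * l z i ^ 2) / 2 +
        C * A ^ 3 * r ^ 3 * (1 + ‖z‖ ^ 2) ^ 3) := by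
    intro z
    have := hC (M * N) (2 * M * N ^ 2 * I₁) r (1 + ‖z‖ ^ 2) m (fun i => g i (r • T i z))
      (fun i => ⟪v i 0, r • T i z⟫) (by positivity) (by positivity) hr0 hr1
      (by linarith [sq_nonneg ‖z‖]) hmε hmM (fun i => (hg i).lower _) (fun i => (hg i).upper _)
      (hlb z) (hxl z)
    simpa only [hx, hl'] using this
  have hxi : ∀ i, Integrable (fun z => x z i) γ := fun i =>
    ((hgi i).div_const _).sub (integrable_const _)
  have hx0 : ∀ i, ∫ z, x z i ∂γ = 0 := fun i => by
    simp only [hx]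
    rw [integral_sub ((hgi i).div_const _) (integrable_const _), integral_div]
    rw [div_self (hm0 i).ne']
    simp
  have hlsum : ∀ z, ∑ i, c i * l z i = ⟪∑ i, c i • (T i).adjoint (w i), z⟫ := fun z => by
    rw [sum_inner]
    simp [hl, inner_smul_left]
  have i1 : Integrable (fun z => ∑ i, c i * x z i) γ :=
    integrable_finsetSum _ fun i _ => (hxi i).const_mul _
  have i2 : Integrable (fun z => (∑ i, c i * l z i) ^ 2) γ := by
    simp only [hlsum]; exact integrable_inner_sq_stdGaussian _
  have i3' : ∀ i, Integrable (fun z => c i * l z i ^ 2) γ :=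
    fun i => (integrable_inner_sq_stdGaussian _).const_mul _
  have i3 : Integrable (fun z => ∑ i, c i * l z i ^ 2) γ :=
    integrable_finsetSum _ fun i _ => i3' i
  have i4 : Integrable (fun z : E => C * A ^ 3 * r ^ 3 * (1 + ‖z‖ ^ 2) ^ 3) γ := int3.const_mul _
  have i5 : Integrable (fun z => 1 + ∑ i, c i * x z i) γ := (integrable_const 1).add i1
  have i6 : Integrable (fun z => ((∑ i, c i * l z i) ^ 2 - ∑ i, c i * l z i ^ 2) / 2) γ :=
    (i2.sub i3).div_const 2
  have lhs_int : Integrable (fun z => ∏ i, g i (r • T i z) ^ c i) γ := by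
    refine Integrable.of_bound (C := ∏ i, M ^ c i) ?_ (Filter.Eventually.of_forall fun z => ?_)
    · refine (Finset.measurable_prod _ fun i _ => ?_).aestronglyMeasurable
      exact ((hg i).measurable.comp (by fun_prop)).pow_const _
    · have := prod_rpow_mem_Icc hc (y := fun i => g i (r • T i z))
        (fun i => hε.le.trans ((hg i).lower _)) (fun i => (hg i).upper _)
      rw [Real.norm_of_nonneg this.1]; exact this.2
  refine (integral_mono lhs_int (((i5.add i6).add i4).const_mul _) hpt).trans ?_
  rw [integral_const_mul, mul_comm]
  refine mul_le_mul_of_nonneg_right ?_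
    (Finset.prod_nonneg fun i _ => Real.rpow_nonneg (hm0 i).le _)
  have s1 : ∫ z, ∑ i, c i * x z i ∂γ = 0 := by
    rw [integral_finsetSum _ fun i _ => (hxi i).const_mul _]
    simp [integral_const_mul, hx0]
  have s2 : ∫ z, (∑ i, c i * l z i) ^ 2 ∂γ = ‖∑ i, c i • (T i).adjoint (w i)‖ ^ 2 := by
    simp only [hlsum]; exact integral_inner_sq_stdGaussian _
  have s3 : ∫ z, ∑ i, c i * l z i ^ 2 ∂γ = ∑ i, c i * ‖(T i).adjoint (w i)‖ ^ 2 := by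
    rw [integral_finsetSum _ fun i _ => i3' i]
    refine Finset.sum_congr rfl fun i _ => ?_
    rw [integral_const_mul, ← integral_inner_sq_stdGaussian]
  rw [integral_add' (i5.add i6) i4, integral_add' i5 i6, integral_add (integrable_const _) i1, s1,
    integral_div, integral_sub i2 i3, s2, s3, integral_const_mul]
  have := hT w
  simp only [integral_const, probReal_univ, smul_eq_mul]
  linarith

end OneStep

theorem IsTame.mono {H : Type*} [NormedAddCommGroup H] [InnerProductSpace ℝ H]
    [MeasurableSpace H] {ε M M' : ℝ} {g : H → ℝ} (hg : IsTame ε M g) (h : M ≤ M') :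
    IsTame ε M' g := by
  obtain ⟨v, hv, hvM, hexp⟩ := hg.expansion
  exact ⟨hg.measurable, hg.lower, fun y => (hg.upper y).trans h, v, hv,
    fun y => (hvM y).trans h, fun y t => (hexp y t).trans (by gcongr)⟩

theorem IsTame.comp_add_right {H : Type*} [NormedAddCommGroup H] [InnerProductSpace ℝ H]
    [FiniteDimensional ℝ H] [MeasurableSpace H] [BorelSpace H] {ε M : ℝ} {g : H → ℝ}
    (hg : IsTame ε M g) (a : H) :
    IsTame ε M (fun y => g (y + a)) := by
  obtain ⟨v, hv, hvM, hexp⟩ := hg.expansion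
  refine ⟨hg.measurable.comp (measurable_add_const a), fun y => hg.lower _, fun y => hg.upper _,
    fun y => v (y + a), hv.comp (measurable_add_const a), fun y => hvM _, fun y t => ?_⟩
  rw [add_right_comm]
  exact hexp _ _

theorem measurable_prod_comp {ι : Type*} [Fintype ι] {E : Type*} [NormedAddCommGroup E]
    [InnerProductSpace ℝ E] [MeasurableSpace E] [BorelSpace E] {H : ι → Type*}
    [∀ i, NormedAddCommGroup (H i)] [∀ i, InnerProductSpace ℝ (H i)]
    [∀ i, MeasurableSpace (H i)] [∀ i, BorelSpace (H i)]
    {c : ι → ℝ} {g : ∀ i, H i → ℝ} (hg : ∀ i, Measurable (g i))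
    (T : ∀ i, E →L[ℝ] H i) (r : ℝ) : Measurable fun z => ∏ i, g i (r • T i z) ^ c i :=
  Finset.measurable_prod _ fun i _ => ((hg i).comp (by fun_prop)).pow_const _

theorem abs_prod_comp_le {ι : Type*} [Fintype ι] {E : Type*} [NormedAddCommGroup E]
    [InnerProductSpace ℝ E] {H : ι → Type*} [∀ i, NormedAddCommGroup (H i)]
    [∀ i, InnerProductSpace ℝ (H i)] [∀ i, MeasurableSpace (H i)]
    {c : ι → ℝ} (hc : ∀ i, 0 < c i) {ε M : ℝ} (hε : 0 ≤ ε)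
    {g : ∀ i, H i → ℝ} (hg : ∀ i, IsTame ε M (g i)) (T : ∀ i, E →L[ℝ] H i) (r : ℝ) (z : E) :
    |∏ i, g i (r • T i z) ^ c i| ≤ ∏ i, M ^ c i := by
  have := prod_rpow_mem_Icc hc (y := fun i => g i (r • T i z))
    (fun i => hε.trans ((hg i).lower _)) (fun i => (hg i).upper _)
  rw [abs_of_nonneg this.1]
  exact this.2

theorem integrable_prod_comp {ι : Type*} [Fintype ι] {E : Type*} [NormedAddCommGroup E]
    [InnerProductSpace ℝ E] [FiniteDimensional ℝ E] [MeasurableSpace E] [BorelSpace E]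
    {H : ι → Type*} [∀ i, NormedAddCommGroup (H i)] [∀ i, InnerProductSpace ℝ (H i)]
    [∀ i, MeasurableSpace (H i)] [∀ i, BorelSpace (H i)]
    {c : ι → ℝ} (hc : ∀ i, 0 < c i) {ε M : ℝ} (hε : 0 ≤ ε)
    {g : ∀ i, H i → ℝ} (hg : ∀ i, IsTame ε M (g i)) (T : ∀ i, E →L[ℝ] H i) (r : ℝ) :
    Integrable (fun z => ∏ i, g i (r • T i z) ^ c i) (stdGaussian E) :=
  Integrable.of_bound (measurable_prod_comp (fun i => (hg i).measurable) T r).aestronglyMeasurable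
    _ (Filter.Eventually.of_forall (abs_prod_comp_le hc hε hg T r))

section Doubling

variable {ι : Type*} [Fintype ι] {E : Type*} [NormedAddCommGroup E] [InnerProductSpace ℝ E]
  [FiniteDimensional ℝ E] [MeasurableSpace E] [BorelSpace E] {H : ι → Type*}
  [∀ i, NormedAddCommGroup (H i)] [∀ i, InnerProductSpace ℝ (H i)]
  [∀ i, FiniteDimensional ℝ (H i)] [∀ i, MeasurableSpace (H i)] [∀ i, BorelSpace (H i)]

theorem integral_prod_sqrt_two_mul_smul_le {c : ι → ℝ} (hc : ∀ i, 0 < c i)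
    (T : ∀ i, E →L[ℝ] H i) {ε M : ℝ} (hε : 0 < ε) {K r : ℝ} (hK : 0 ≤ K)
    (h : ∀ g : ∀ i, H i → ℝ, (∀ i, IsTame ε M (g i)) →
      ∫ z, ∏ i, g i (r • T i z) ^ c i ∂(stdGaussian E) ≤
        K * ∏ i, (∫ z, g i (r • T i z) ∂(stdGaussian E)) ^ c i)
    (g : ∀ i, H i → ℝ) (hg : ∀ i, IsTame ε M (g i)) :
    ∫ z, ∏ i, g i ((√2 * r) • T i z) ^ c i ∂(stdGaussian E) ≤
      K ^ 2 * ∏ i, (∫ z, g i ((√2 * r) • T i z) ∂(stdGaussian E)) ^ c i := by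
  set γ := stdGaussian E with hγ
  have hsc : ∀ i (z : E), (√2 * r) • T i z = r • T i (√2 • z) := fun i z => by
    rw [map_smul, smul_smul, mul_comm]
  set G : ∀ i, H i → ℝ := fun i y => ∫ z', g i (y + r • T i z') ∂γ with hG
  have hGt : ∀ i, IsTame ε M (G i) := fun i => by
    have := (hg i).average hε.le γ (τ := fun z' => r • T i z') (by fun_prop)
    simpa using this
  have e1 := integral_sqrt_two_smul_stdGaussian (F := fun z : E => ∏ i, g i (r • T i z) ^ c i)
    (measurable_prod_comp (fun i => (hg i).measurable) T r) (abs_prod_comp_le hc hε.le hg T r)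
  have e2 : ∀ i, ∫ z, g i (r • T i (√2 • z)) ∂γ = ∫ z, G i (r • T i z) ∂γ := fun i => by
    rw [integral_sqrt_two_smul_stdGaussian (F := fun z : E => g i (r • T i z))
      ((hg i).measurable.comp (by fun_prop)) (M := M) (fun z => (hg i).abs_le hε.le _)]
    simp only [hG, map_add, smul_add]
    rfl
  simp only [hsc, e2]
  rw [e1]
  have hin : ∀ z : E, ∫ z', ∏ i, g i (r • T i (z + z')) ^ c i ∂γ ≤
      K * ∏ i, G i (r • T i z) ^ c i := fun z => by
    have := h (fun i y => g i (y + r • T i z)) fun i => (hg i).comp_add_right _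
    simp only [hG]
    simp only [map_add, smul_add]
    simpa only [add_comm] using this
  calc _ ≤ ∫ z, K * ∏ i, G i (r • T i z) ^ c i ∂γ := by
        refine integral_mono ?_ ((integrable_prod_comp hc hε.le hGt T r).const_mul K) hin
        refine Integrable.integral_prod_left (f := fun p : E × E =>
          ∏ i, g i (r • T i (p.1 + p.2)) ^ c i) ?_
        exact Integrable.of_bound ((measurable_prod_comp (fun i => (hg i).measurable) T r).comp
          (measurable_fst.add measurable_snd)).aestronglyMeasurable _
          (Filter.Eventually.of_forall fun p => abs_prod_comp_le hc hε.le hg T r (p.1 + p.2))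
    _ = K * ∫ z, ∏ i, G i (r • T i z) ^ c i ∂γ := integral_const_mul _ _
    _ ≤ K * (K * ∏ i, (∫ z, G i (r • T i z) ∂γ) ^ c i) :=
        mul_le_mul_of_nonneg_left (h G hGt) hK
    _ = _ := by ring

/-- The Gaussian Brascamp--Lieb inequality for bounded below smooth inputs. -/
theorem integral_prod_le_of_isTame {c : ι → ℝ} (hc : ∀ i, 0 < c i) (T : ∀ i, E →L[ℝ] H i)
    (hT : ∀ w : ∀ i, H i, ‖∑ i, c i • (T i).adjoint (w i)‖ ^ 2 ≤
      ∑ i, c i * ‖(T i).adjoint (w i)‖ ^ 2) {ε M : ℝ} (hε : 0 < ε) (hM : 0 < M)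
    {g : ∀ i, H i → ℝ} (hg : ∀ i, IsTame ε M (g i)) :
    ∫ z, ∏ i, g i (T i z) ^ c i ∂(stdGaussian E) ≤
      ∏ i, (∫ z, g i (T i z) ∂(stdGaussian E)) ^ c i := by
  obtain ⟨C, hC0, hC⟩ := exists_integral_prod_smul_le c hc T hT hε hM
  have hs0 : 0 < √2 := by positivity
  have key : ∀ m : ℕ, ∀ r : ℝ, 0 ≤ r → r ≤ 1 → ∀ g : ∀ i, H i → ℝ, (∀ i, IsTame ε M (g i)) →
      ∫ z, ∏ i, g i ((√2 ^ m * r) • T i z) ^ c i ∂(stdGaussian E) ≤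
        (1 + C * r ^ 3) ^ 2 ^ m *
          ∏ i, (∫ z, g i ((√2 ^ m * r) • T i z) ∂(stdGaussian E)) ^ c i := by
    intro m r hr0 hr1
    induction m with
    | zero => simpa using hC r hr0 hr1
    | succ m ih =>
      have := integral_prod_sqrt_two_mul_smul_le hc T hε (by positivity) ih
      rw [pow_succ' √2, mul_assoc, pow_succ 2, pow_mul]
      exact this
  set P := ∏ i, (∫ z, g i (T i z) ∂(stdGaussian E)) ^ c i with hP
  have hP0 : 0 ≤ P := Finset.prod_nonneg fun i _ => Real.rpow_nonneg
    (integral_nonneg fun z => hε.le.trans ((hg i).lower _)) _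
  have hbd : ∀ m : ℕ, ∫ z, ∏ i, g i (T i z) ^ c i ∂(stdGaussian E) ≤
      Real.exp (C * (√2)⁻¹ ^ m) * P := by
    intro m
    have h1 := key m ((√2)⁻¹ ^ m) (by positivity)
      (pow_le_one₀ (by positivity) (inv_le_one_of_one_le₀ (Real.one_le_sqrt.2 (by norm_num)))) g hg
    have e : √2 ^ m * (√2)⁻¹ ^ m = 1 := by
      rw [← mul_pow, mul_inv_cancel₀ hs0.ne', one_pow]
    simp only [e, one_smul] at h1
    refine h1.trans (mul_le_mul_of_nonneg_right ?_ hP0)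
    have h2 : 1 + C * ((√2)⁻¹ ^ m) ^ 3 ≤ Real.exp (C * ((√2)⁻¹ ^ m) ^ 3) := by
      linarith [Real.add_one_le_exp (C * ((√2)⁻¹ ^ m) ^ 3)]
    refine (pow_le_pow_left₀ (by positivity) h2 _).trans_eq ?_
    rw [← Real.exp_nat_mul]
    congr 1
    push_cast
    have e2 : (2 : ℝ) ^ m = (√2 ^ m) ^ 2 := by
      rw [← pow_mul, mul_comm, pow_mul, Real.sq_sqrt (by norm_num)]
    rw [e2]
    calc (√2 ^ m) ^ 2 * (C * ((√2)⁻¹ ^ m) ^ 3)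
        = C * (√2)⁻¹ ^ m * (√2 ^ m * (√2)⁻¹ ^ m) ^ 2 := by ring
      _ = _ := by rw [e]; ring
  have hlim : Filter.Tendsto (fun m : ℕ => Real.exp (C * (√2)⁻¹ ^ m) * P) Filter.atTop
      (nhds (Real.exp (C * 0) * P)) := by
    refine Filter.Tendsto.mul_const _ ((Real.continuous_exp.tendsto _).comp
      (Filter.Tendsto.const_mul _ (tendsto_pow_atTop_nhds_zero_of_lt_one (by positivity) ?_)))
    exact inv_lt_one_of_one_lt₀ (by rw [Real.lt_sqrt] <;> norm_num)
  rw [mul_zero, Real.exp_zero, one_mul] at hlim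
  exact ge_of_tendsto' hlim hbd

theorem lintegral_prod_le_of_isTame {c : ι → ℝ} (hc : ∀ i, 0 < c i) (T : ∀ i, E →L[ℝ] H i)
    (hT : ∀ w : ∀ i, H i, ‖∑ i, c i • (T i).adjoint (w i)‖ ^ 2 ≤
      ∑ i, c i * ‖(T i).adjoint (w i)‖ ^ 2)
    {g : ∀ i, H i → ℝ} (hg : ∀ i, ∃ M, IsTame 0 M (g i)) :
    ∫⁻ z, ∏ i, ENNReal.ofReal (g i (T i z)) ^ c i ∂(stdGaussian E) ≤
      ∏ i, (∫⁻ z, ENNReal.ofReal (g i (T i z)) ∂(stdGaussian E)) ^ c i := by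
  choose M' hM' using hg
  have hM'0 : ∀ i, 0 ≤ M' i := fun i => ((hM' i).lower 0).trans ((hM' i).upper 0)
  set M := 1 + ∑ i, M' i with hM
  have hM1 : 0 < M := by
    have : 0 ≤ ∑ i, M' i := Finset.sum_nonneg fun i _ => hM'0 i
    linarith
  have hg : ∀ i, IsTame 0 M (g i) := fun i => (hM' i).mono (by
    have := Finset.single_le_sum (f := M') (fun j _ => hM'0 j) (Finset.mem_univ i)
    linarith)
  have hgi : ∀ i, Integrable (fun z => g i (T i z)) (stdGaussian E) := fun i =>
    (hg i).integrable_comp le_rfl (by fun_prop)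
  have hInt := integrable_prod_comp (c := c) hc le_rfl hg T 1
  simp only [one_smul] at hInt
  have hreal : ∫ z, ∏ i, g i (T i z) ^ c i ∂(stdGaussian E) ≤
      ∏ i, (∫ z, g i (T i z) ∂(stdGaussian E)) ^ c i := by
    have hlim : Filter.Tendsto
        (fun a : ℝ => ∏ i, ((∫ z, g i (T i z) ∂(stdGaussian E)) + a) ^ c i)
        (nhdsWithin 0 (Set.Ioi 0))
        (nhds (∏ i, ((∫ z, g i (T i z) ∂(stdGaussian E)) + 0) ^ c i)) := by
      refine Filter.Tendsto.mono_left (Continuous.tendsto ?_ 0) nhdsWithin_le_nhds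
      refine continuous_finsetProd _ fun i _ => ?_
      exact (continuous_const.add continuous_id).rpow_const fun _ => Or.inr (hc i).le
    simp only [add_zero] at hlim
    refine ge_of_tendsto hlim (Filter.eventually_of_mem self_mem_nhdsWithin fun a ha => ?_)
    rw [Set.mem_Ioi] at ha
    have hga : ∀ i, IsTame a (M + a) (fun y => g i y + a) := fun i => by
      simpa using (hg i).add_const ha.le
    have h1 := integral_prod_le_of_isTame hc T hT ha (by positivity) hga
    have hInt' := integrable_prod_comp (c := c) hc ha.le hga T 1
    simp only [one_smul] at hInt'
    refine (integral_mono hInt hInt' fun z => ?_).trans (h1.trans_eq ?_)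
    · refine Finset.prod_le_prod (fun i _ => Real.rpow_nonneg ((hg i).lower _) _) fun i _ => ?_
      exact Real.rpow_le_rpow ((hg i).lower _) (by linarith) (hc i).le
    · refine Finset.prod_congr rfl fun i _ => ?_
      rw [integral_add (hgi i) (integrable_const _)]
      simp
  have e1 : ∀ z, ∏ i, ENNReal.ofReal (g i (T i z)) ^ c i =
      ENNReal.ofReal (∏ i, g i (T i z) ^ c i) := fun z => by
    rw [ENNReal.ofReal_prod_of_nonneg fun i _ => Real.rpow_nonneg ((hg i).lower _) _]
    exact Finset.prod_congr rfl fun i _ => ENNReal.ofReal_rpow_of_nonneg ((hg i).lower _) (hc i).le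
  have e2 : ∀ i, ∫⁻ z, ENNReal.ofReal (g i (T i z)) ∂(stdGaussian E) =
      ENNReal.ofReal (∫ z, g i (T i z) ∂(stdGaussian E)) := fun i =>
    (ofReal_integral_eq_lintegral_ofReal (hgi i)
      (Filter.Eventually.of_forall fun z => (hg i).lower _)).symm
  have hnn : ∀ i, 0 ≤ ∫ z, g i (T i z) ∂(stdGaussian E) := fun i =>
    integral_nonneg fun z => (hg i).lower _
  simp only [e1, e2]
  rw [← ofReal_integral_eq_lintegral_ofReal hInt (Filter.Eventually.of_forall fun z =>
    Finset.prod_nonneg fun i _ => Real.rpow_nonneg ((hg i).lower _) _)]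
  refine (ENNReal.ofReal_le_ofReal hreal).trans_eq ?_
  rw [ENNReal.ofReal_prod_of_nonneg fun i _ => Real.rpow_nonneg (hnn i) _]
  exact Finset.prod_congr rfl fun i _ => (ENNReal.ofReal_rpow_of_nonneg (hnn i) (hc i).le).symm

end Doubling

section Density

variable {E : Type*} [NormedAddCommGroup E] [InnerProductSpace ℝ E] [FiniteDimensional ℝ E]
  [MeasurableSpace E] [BorelSpace E]

theorem integrable_exp_neg_norm_sq_div_two :
    Integrable fun x : E => Real.exp (-‖x‖ ^ 2 / 2) := by
  have h := GaussianFourier.integrable_cexp_neg_mul_sq_norm_add (V := E) (b := 1 / 2)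
    (by norm_num) 0 0
  have h2 := h.re
  refine h2.congr (Filter.Eventually.of_forall fun x => ?_)
  simp only [zero_mul, add_zero, RCLike.re_to_complex]
  rw [show -(1 / 2 : ℂ) * (‖x‖ : ℂ) ^ 2 = ((-‖x‖ ^ 2 / 2 : ℝ) : ℂ) by push_cast; ring,
    Complex.exp_ofReal_re]

theorem stdGaussian_eq_withDensity :
    stdGaussian E = volume.withDensity fun x : E => ENNReal.ofReal
      ((2 * Real.pi) ^ (-(Module.finrank ℝ E / 2 : ℝ)) * Real.exp (-‖x‖ ^ 2 / 2)) := by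
  have : IsFiniteMeasure (volume.withDensity fun x : E => ENNReal.ofReal
      ((2 * Real.pi) ^ (-(Module.finrank ℝ E / 2 : ℝ)) * Real.exp (-‖x‖ ^ 2 / 2))) :=
    isFiniteMeasure_withDensity_ofReal
      (integrable_exp_neg_norm_sq_div_two.const_mul _).hasFiniteIntegral
  refine Measure.ext_of_charFun ?_
  ext t
  rw [charFun_stdGaussian, charFun_apply, integral_withDensity_eq_integral_toReal_smul
    (by fun_prop) (Filter.Eventually.of_forall fun x => ENNReal.ofReal_lt_top)]
  have h := GaussianFourier.integral_cexp_neg_mul_sq_norm_add (V := E) (b := 1 / 2)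
    (by norm_num) Complex.I t
  have hpi : (0 : ℝ) < 2 * Real.pi := by positivity
  have e : ∀ x : E, (ENNReal.ofReal ((2 * Real.pi) ^ (-(Module.finrank ℝ E / 2 : ℝ)) *
      Real.exp (-‖x‖ ^ 2 / 2))).toReal • Complex.exp (⟪x, t⟫ * Complex.I) =
      (((2 * Real.pi) ^ (-(Module.finrank ℝ E / 2 : ℝ)) : ℝ) : ℂ) *
        Complex.exp (-(1 / 2) * ‖x‖ ^ 2 + Complex.I * ⟪t, x⟫) := fun x => by
    rw [ENNReal.toReal_ofReal (by positivity), Complex.real_smul, Complex.ofReal_mul,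
      Complex.ofReal_exp, mul_assoc, ← Complex.exp_add, real_inner_comm]
    congr 2
    push_cast
    ring
  simp only [e]
  rw [integral_const_mul, h]
  have e3 : ((Real.pi : ℂ) / (1 / 2)) ^ ((Module.finrank ℝ E : ℂ) / 2) =
      (((2 * Real.pi) ^ (Module.finrank ℝ E / 2 : ℝ) : ℝ) : ℂ) := by
    rw [Complex.ofReal_cpow hpi.le]
    push_cast
    congr 1
    ring
  rw [e3, ← mul_assoc, ← Complex.ofReal_mul, ← Real.rpow_add hpi]
  simp only [neg_add_cancel, Real.rpow_zero, Complex.ofReal_one, one_mul, Complex.I_sq]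
  congr 1
  ring

theorem lintegral_stdGaussian {f : E → ℝ≥0∞} (hf : Measurable f) :
    ∫⁻ x, f x ∂(stdGaussian E) = ENNReal.ofReal ((2 * Real.pi) ^ (-(Module.finrank ℝ E / 2 : ℝ))) *
      ∫⁻ x, ENNReal.ofReal (Real.exp (-‖x‖ ^ 2 / 2)) * f x := by
  rw [stdGaussian_eq_withDensity, lintegral_withDensity_eq_lintegral_mul _ (by fun_prop) hf,
    ← lintegral_const_mul _ (by fun_prop)]
  refine lintegral_congr fun x => ?_
  rw [Pi.mul_apply, ENNReal.ofReal_mul (by positivity), mul_assoc]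

theorem lintegral_exp_mul_eq_stdGaussian {f : E → ℝ≥0∞} (hf : Measurable f) :
    ∫⁻ x, ENNReal.ofReal (Real.exp (-‖x‖ ^ 2 / 2)) * f x =
      ENNReal.ofReal ((2 * Real.pi) ^ (Module.finrank ℝ E / 2 : ℝ)) *
        ∫⁻ x, f x ∂(stdGaussian E) := by
  rw [lintegral_stdGaussian hf, ← mul_assoc, ← ENNReal.ofReal_mul (by positivity),
    ← Real.rpow_add (by positivity)]
  simp

theorem lintegral_comp_linearMap {W : E →ₗ[ℝ] E} (hW : W.det ≠ 0) {f : E → ℝ≥0∞}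
    (hf : Measurable f) :
    ENNReal.ofReal |W.det| * ∫⁻ x, f (W x) = ∫⁻ x, f x := by
  have hWm : Measurable W := W.continuous_of_finiteDimensional.measurable
  rw [← lintegral_map hf hWm, Measure.map_linearMap_addHaar_eq_smul_addHaar _ hW,
    lintegral_smul_measure, smul_eq_mul, ← mul_assoc, ← ENNReal.ofReal_mul (abs_nonneg _),
    ← abs_mul, mul_inv_cancel₀ hW]
  simp

theorem integral_norm_sq_stdGaussian {H : Type*} [NormedAddCommGroup H] [InnerProductSpace ℝ H]
    [FiniteDimensional ℝ H] (P : E →L[ℝ] H) (hP : ∀ w, ‖P.adjoint w‖ = ‖w‖) :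
    Integrable (fun z => ‖P z‖ ^ 2) (stdGaussian E) ∧
      ∫ z, ‖P z‖ ^ 2 ∂(stdGaussian E) = Module.finrank ℝ H := by
  set b := stdOrthonormalBasis ℝ H
  have e : ∀ z, ‖P z‖ ^ 2 = ∑ j, ⟪P.adjoint (b j), z⟫ ^ 2 := fun z => by
    rw [← b.sum_sq_norm_inner_right]
    refine Finset.sum_congr rfl fun j _ => ?_
    rw [Real.norm_eq_abs, sq_abs, ContinuousLinearMap.adjoint_inner_left]
  simp only [e]
  refine ⟨integrable_finsetSum _ fun j _ => integrable_inner_sq_stdGaussian _, ?_⟩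
  rw [integral_finsetSum _ fun j _ => integrable_inner_sq_stdGaussian _]
  simp [integral_inner_sq_stdGaussian, hP]

theorem map_stdGaussian_of_norm_adjoint {H : Type*} [NormedAddCommGroup H] [InnerProductSpace ℝ H]
    [FiniteDimensional ℝ H] [MeasurableSpace H] [BorelSpace H] (P : E →L[ℝ] H)
    (hP : ∀ w, ‖P.adjoint w‖ = ‖w‖) : (stdGaussian E).map P = stdGaussian H := by
  have : IsProbabilityMeasure ((stdGaussian E).map P) :=
    Measure.isProbabilityMeasure_map (by fun_prop)
  refine Measure.ext_of_charFun ?_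
  ext t
  have h : charFun ((stdGaussian E).map P) t = charFun (stdGaussian E) (P.adjoint t) := by
    rw [charFun_apply, charFun_apply, integral_map (by fun_prop) (by fun_prop)]
    simp only [ContinuousLinearMap.adjoint_inner_right]
  rw [h, charFun_stdGaussian, charFun_stdGaussian, hP]

end Density

section LinearAlgebra

theorem norm_id_sub_smulRight_le {E : Type*} [NormedAddCommGroup E] [InnerProductSpace ℝ E]
    {u : E} (hu : ‖u‖ = 1) {s : ℝ} (hs0 : 0 ≤ s) (hs1 : s ≤ 1) :
    ‖ContinuousLinearMap.id ℝ E + (-s • innerSL ℝ u).smulRight u‖ ≤ 1 := by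
  refine ContinuousLinearMap.opNorm_le_bound _ zero_le_one fun x => ?_
  rw [one_mul, ← sq_le_sq₀ (norm_nonneg _) (norm_nonneg _)]
  have e : (ContinuousLinearMap.id ℝ E + (-s • innerSL ℝ u).smulRight u) x =
      x - (s * ⟪u, x⟫) • u := by
    simp [sub_eq_add_neg]
  rw [e, norm_sub_sq_real, norm_smul, hu, mul_pow, Real.norm_eq_abs, sq_abs, inner_smul_right,
    real_inner_comm]
  nlinarith [mul_nonneg (mul_nonneg hs0 (by linarith : 0 ≤ 2 - s)) (sq_nonneg ⟪x, u⟫)]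

variable {E H : Type*} [NormedAddCommGroup E] [InnerProductSpace ℝ E] [FiniteDimensional ℝ E]
  [NormedAddCommGroup H] [InnerProductSpace ℝ H] [FiniteDimensional ℝ H]

theorem det_adjoint (W : H →L[ℝ] H) : W.adjoint.det = W.det := by
  have h := LinearMap.toMatrix_adjoint (stdOrthonormalBasis ℝ H) (stdOrthonormalBasis ℝ H)
    (W : H →ₗ[ℝ] H)
  change (LinearMap.det ((W : H →ₗ[ℝ] H).adjoint)) = LinearMap.det (W : H →ₗ[ℝ] H)
  rw [← LinearMap.det_toMatrix (stdOrthonormalBasis ℝ H).toBasis, h, Matrix.det_conjTranspose,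
    LinearMap.det_toMatrix]
  rfl

/-- The square root of `det (T ∘ T†)`. -/
noncomputable def gramNorm (T : E →L[ℝ] H) : ℝ :=
  LinearMap.normDet (T.adjoint : H →ₗ[ℝ] E)

theorem gramNorm_eq_sqrt (T : E →L[ℝ] H) : gramNorm T = √(T ∘L T.adjoint).det := by
  have h := ContinuousLinearMap.normDet_sq (𝕜 := ℝ) T.adjoint
  rw [ContinuousLinearMap.adjoint_adjoint] at h
  rw [← h]
  exact (Real.sqrt_sq (LinearMap.normDet_nonneg _)).symm

theorem adjoint_injective {T : E →L[ℝ] H} (hT : Function.Surjective T) :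
    Function.Injective (T.adjoint : H →ₗ[ℝ] E) := by
  rw [← LinearMap.ker_eq_bot, LinearMap.ker_eq_bot']
  intro w hw
  obtain ⟨x, hx⟩ := hT w
  have h : ⟪T.adjoint w, x⟫ = 0 := by
    rw [show T.adjoint w = 0 from hw, inner_zero_left]
  rwa [ContinuousLinearMap.adjoint_inner_left, hx, inner_self_eq_zero] at h

theorem gramNorm_pos {T : E →L[ℝ] H} (hT : Function.Surjective T) : 0 < gramNorm T := by
  refine lt_of_le_of_ne (LinearMap.normDet_nonneg _) (Ne.symm ?_)
  refine ((LinearMap.normDet_ne_zero_tfae (T.adjoint : H →ₗ[ℝ] E)).out 0 4).2 ?_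
  exact adjoint_injective hT

theorem gramNorm_smul (T : E →L[ℝ] H) (r : ℝ) :
    gramNorm (r • T) = |r| ^ Module.finrank ℝ H * gramNorm T := by
  rw [gramNorm, map_smulₛₗ]
  exact LinearMap.normDet_smul _ _

/-- A linear map `W` for which `W ∘ T` is a coisometry. -/
def IsWhitening (T : E →L[ℝ] H) (W : H →L[ℝ] H) : Prop :=
  ∀ w, ‖T.adjoint (W.adjoint w)‖ = ‖w‖

theorem exists_isWhitening {T : E →L[ℝ] H} (hT : Function.Surjective T) :
    ∃ W, IsWhitening T W := by
  have hinj : Function.Injective (T.adjoint : H →ₗ[ℝ] E) := adjoint_injective hT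
  set e := LinearEquiv.ofInjective (T.adjoint : H →ₗ[ℝ] E) hinj with he
  set U := (stdOrthonormalBasis ℝ H).equiv
    (stdOrthonormalBasis ℝ (LinearMap.range (T.adjoint : H →ₗ[ℝ] E)))
    (finCongr e.finrank_eq) with hU
  refine ⟨(LinearMap.toContinuousLinearMap
    (e.symm.toLinearMap ∘ₗ U.toLinearEquiv.toLinearMap)).adjoint, fun w => ?_⟩
  rw [ContinuousLinearMap.adjoint_adjoint]
  have : T.adjoint (e.symm (U w)) = (e (e.symm (U w)) : E) := rfl
  change ‖T.adjoint (e.symm (U w))‖ = _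
  rw [this, e.apply_symm_apply, ← Submodule.coe_norm, U.norm_map]

theorem IsWhitening.abs_det_mul_gramNorm {T : E →L[ℝ] H} {W : H →L[ℝ] H} (h : IsWhitening T W) :
    |W.det| * gramNorm T = 1 := by
  set U : H →ₗᵢ[ℝ] E := ⟨(T.adjoint : H →ₗ[ℝ] E) ∘ₗ (W.adjoint : H →ₗ[ℝ] H), h⟩ with hU
  have h1 := U.normDet_eq_one
  have h2 : U.toLinearMap = (T.adjoint : H →ₗ[ℝ] E) ∘ₗ (W.adjoint : H →ₗ[ℝ] H) := rfl
  rw [h2, LinearMap.normDet_comp_of_finrank_eq _ _ rfl, LinearMap.normDet_eq_abs_det] at h1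
  rw [← det_adjoint, mul_comm]
  exact h1

theorem IsWhitening.det_ne_zero {T : E →L[ℝ] H} {W : H →L[ℝ] H} (h : IsWhitening T W) :
    W.det ≠ 0 := fun h0 => by
  simpa [h0] using h.abs_det_mul_gramNorm

theorem IsWhitening.smul {T : E →L[ℝ] H} {W : H →L[ℝ] H} (h : IsWhitening T W) {r : ℝ}
    (hr : r ≠ 0) : IsWhitening (r • T) (r⁻¹ • W) := fun w => by
  simp [smul_smul, hr, h w]

theorem IsWhitening.norm_adjoint_comp {T : E →L[ℝ] H} {W : H →L[ℝ] H} (h : IsWhitening T W)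
    (w : H) : ‖(W ∘L T).adjoint w‖ = ‖w‖ := by
  rw [ContinuousLinearMap.adjoint_comp]; exact h w

theorem IsWhitening.norm_apply_le {T : E →L[ℝ] H} {W : H →L[ℝ] H} (h : IsWhitening T W)
    (u : E) : ‖W (T u)‖ ≤ ‖u‖ := by
  have h1 : ‖(W ∘L T)‖ ≤ 1 := by
    rw [← LinearIsometryEquiv.norm_map ContinuousLinearMap.adjoint]
    exact ContinuousLinearMap.opNorm_le_bound _ zero_le_one
      fun w => by rw [h.norm_adjoint_comp, one_mul]
  simpa using (W ∘L T).le_of_opNorm_le h1 u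

theorem det_id_add_smulRight (p : H) (κ : ℝ) :
    (ContinuousLinearMap.id ℝ H + (κ • innerSL ℝ p).smulRight p).det = 1 + κ * ‖p‖ ^ 2 := by
  have h := LinearMap.transvection.det (κ • (innerSL ℝ p : H →ₗ[ℝ] ℝ)) p
  have e : ((κ • (innerSL ℝ p : H →ₗ[ℝ] ℝ)) p) = κ * ‖p‖ ^ 2 := by
    simp
  rw [e] at h
  rw [← h]
  rfl

theorem exists_whitening_perturbation (p : H) {τ : ℝ} (hp : τ * ‖p‖ ^ 2 < 1) :
    ∃ K : H →L[ℝ] H, K.det = (√(1 - τ * ‖p‖ ^ 2))⁻¹ ∧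
      ∀ w, ‖K w‖ ^ 2 - τ * ⟪p, K w⟫ ^ 2 = ‖w‖ ^ 2 := by
  set a := √(1 - τ * ‖p‖ ^ 2) with ha
  have ha0 : 0 < a := Real.sqrt_pos.2 (by linarith)
  have ha2 : a ^ 2 = 1 - τ * ‖p‖ ^ 2 := Real.sq_sqrt (by linarith)
  set κ := τ / (a * (1 + a)) with hκ
  have hκp : 1 + κ * ‖p‖ ^ 2 = a⁻¹ := by
    rw [hκ]; field_simp; nlinarith
  refine ⟨ContinuousLinearMap.id ℝ H + (κ • innerSL ℝ p).smulRight p, ?_, fun w => ?_⟩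
  · rw [det_id_add_smulRight, hκp]
  · have e1 : (ContinuousLinearMap.id ℝ H + (κ • innerSL ℝ p).smulRight p) w =
        w + (κ * ⟪p, w⟫) • p := by simp
    have e2 : ⟪p, w + (κ * ⟪p, w⟫) • p⟫ = a⁻¹ * ⟪p, w⟫ := by
      rw [inner_add_right, inner_smul_right, real_inner_self_eq_norm_sq, ← hκp]; ring
    have e3 : ‖w + (κ * ⟪p, w⟫) • p‖ ^ 2 =
        ‖w‖ ^ 2 + κ * (1 + a⁻¹) * ⟪p, w⟫ ^ 2 := by
      rw [norm_add_sq_real, norm_smul, mul_pow, Real.norm_eq_abs, sq_abs, inner_smul_right,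
        real_inner_comm, ← hκp]
      ring
    have e4 : κ * (1 + a⁻¹) = τ * a⁻¹ ^ 2 := by
      rw [hκ]; field_simp; ring
    rw [e1, e2, e3, e4]
    ring

theorem gramNorm_comp_perturbation {T : E →L[ℝ] H} {W : H →L[ℝ] H} (h : IsWhitening T W) {u : E}
    (hu : ‖u‖ = 1) {s : ℝ} (hs : (2 * s - s ^ 2) * ‖W (T u)‖ ^ 2 < 1) :
    gramNorm (T ∘L (ContinuousLinearMap.id ℝ E + (-s • innerSL ℝ u).smulRight u)) =
      gramNorm T * √(1 - (2 * s - s ^ 2) * ‖W (T u)‖ ^ 2) := by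
  set Q := ContinuousLinearMap.id ℝ E + (-s • innerSL ℝ u).smulRight u with hQ
  have hQe : ∀ x, Q x = x - (s * ⟪u, x⟫) • u := fun x => by
    simp [hQ, sub_eq_add_neg]
  have hQa : Q.adjoint = Q := by
    symm
    rw [ContinuousLinearMap.eq_adjoint_iff]
    intro x y
    rw [hQe, hQe, inner_sub_left, inner_sub_right, inner_smul_left, inner_smul_right,
      real_inner_comm u x]
    simp; ring
  obtain ⟨K, hKd, hK⟩ := exists_whitening_perturbation (W (T u)) hs
  have hKa : IsWhitening (T ∘L Q) (K.adjoint ∘L W) := fun w => by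
    rw [ContinuousLinearMap.adjoint_comp, ContinuousLinearMap.adjoint_comp, hQa,
      ContinuousLinearMap.adjoint_adjoint]
    rw [← sq_eq_sq₀ (norm_nonneg _) (norm_nonneg _), ← hK w]
    simp only [ContinuousLinearMap.comp_apply]
    rw [hQe, norm_sub_sq_real, norm_smul, hu, mul_pow, Real.norm_eq_abs, sq_abs, inner_smul_right,
      h, real_inner_comm u, ContinuousLinearMap.adjoint_inner_right,
      ContinuousLinearMap.adjoint_inner_right]
    ring
  have h1 := hKa.abs_det_mul_gramNorm
  have h2 := h.abs_det_mul_gramNorm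
  have hd : (K.adjoint ∘L W).det = K.det * W.det := by
    rw [← det_adjoint K]
    exact LinearMap.det_comp _ _
  have h0 := abs_pos.2 h.det_ne_zero
  have ha0 : 0 < √(1 - (2 * s - s ^ 2) * ‖W (T u)‖ ^ 2) := Real.sqrt_pos.2 (by linarith)
  rw [hd, hKd, abs_mul, abs_of_pos (inv_pos.2 ha0)] at h1
  refine mul_left_cancel₀ h0.ne' ?_
  generalize √(1 - (2 * s - s ^ 2) * ‖W (T u)‖ ^ 2) = a at *
  rw [← mul_assoc, h2, one_mul, ← mul_one a, ← h1]
  field_simp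

theorem abs_det_le_norm_apply {L : E →L[ℝ] E} (hL : ‖L‖ ≤ 1) {u : E} (hu : ‖u‖ = 1) :
    |L.det| ≤ ‖L u‖ := by
  have hL1 : ∀ x, ‖x‖ = 1 → ‖L x‖ ≤ 1 := fun x hx => by
    simpa [hx] using L.le_of_opNorm_le hL x
  obtain ⟨n, hn⟩ : ∃ n, Module.finrank ℝ E = n + 1 := by
    have : Nontrivial E := ⟨u, 0, fun h => by simp [h] at hu⟩
    exact Nat.exists_eq_succ_of_ne_zero Module.finrank_pos.ne'
  have : Fact (Module.finrank ℝ E = n + 1) := ⟨hn⟩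
  obtain ⟨b, hb⟩ := Orthonormal.exists_orthonormalBasis_extension_of_card_eq (𝕜 := ℝ) (E := E)
    (ι := Fin (n + 1)) (by simpa using hn) (v := fun _ => u) (s := {0}) (by
      constructor
      · intro i; simpa using hu
      · intro i j hij; exact absurd (Subsingleton.elim i j) hij)
  have h0 : b 0 = u := hb 0 rfl
  have h := Orientation.abs_volumeForm_apply_le b.toBasis.orientation (L ∘ b)
  rw [Orientation.volumeForm_robust _ b rfl] at h
  have h2 := b.toBasis.det_comp (L : E →ₗ[ℝ] E) b
  have h3 : b.toBasis.det b = 1 := by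
    have := b.toBasis.det_self
    simpa using this
  rw [h3, mul_one] at h2
  have h4 : b.toBasis.det (L ∘ b) = L.det := h2
  rw [h4, Fin.prod_univ_succ] at h
  refine h.trans ?_
  rw [Function.comp_apply, h0]
  refine mul_le_of_le_one_right (norm_nonneg _) (Finset.prod_le_one (fun _ _ => norm_nonneg _) ?_)
  intro i _
  exact hL1 _ (b.orthonormal.1 _)

theorem abs_det_mul_norm_le {L : E →L[ℝ] E} (hL : ‖L‖ ≤ 1) (z : E) :
    |L.det| * ‖z‖ ≤ ‖L z‖ := by
  rcases eq_or_ne z 0 with rfl | h0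
  · simp
  have h0' := norm_pos_iff.2 h0
  have h := abs_det_le_norm_apply hL (u := ‖z‖⁻¹ • z)
    (by rw [norm_smul, norm_inv, norm_norm, inv_mul_cancel₀ h0'.ne'])
  rwa [map_smul, norm_smul, norm_inv, norm_norm, inv_mul_eq_div, le_div_iff₀ h0'] at h

theorem abs_det_le_one {L : E →L[ℝ] E} (hL : ‖L‖ ≤ 1) : |L.det| ≤ 1 := by
  rcases subsingleton_or_nontrivial E with h | h
  · have : L.det = 1 := LinearMap.det_eq_one_of_subsingleton _
    simp [this]
  · obtain ⟨u, hu⟩ := exists_norm_eq E zero_le_one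
    have h1 := abs_det_mul_norm_le hL u
    have h2 := L.le_of_opNorm_le hL u
    rw [hu] at h1 h2
    linarith

end LinearAlgebra

theorem one_le_lintegral_exp {α : Type*} [MeasurableSpace α] {μ : Measure α}
    [IsProbabilityMeasure μ] {φ : α → ℝ} (hφ : Integrable φ μ) (h0 : ∫ x, φ x ∂μ = 0) :
    1 ≤ ∫⁻ x, ENNReal.ofReal (Real.exp (φ x)) ∂μ := by
  have h1 : ENNReal.ofReal (∫ x, (φ x + 1) ∂μ) ≤ ∫⁻ x, ENNReal.ofReal (φ x + 1) ∂μ := by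
    have hi : Integrable (fun x => φ x + 1) μ := hφ.add (integrable_const 1)
    rw [integral_eq_lintegral_pos_part_sub_lintegral_neg_part hi]
    refine (ENNReal.ofReal_le_ofReal (sub_le_self _ ENNReal.toReal_nonneg)).trans ?_
    exact ENNReal.ofReal_toReal_le
  have h2 : ∫ x, (φ x + 1) ∂μ = 1 := by
    rw [integral_add hφ (integrable_const 1), h0]; simp
  rw [h2, ENNReal.ofReal_one] at h1
  exact h1.trans (lintegral_mono fun x => ENNReal.ofReal_le_ofReal (Real.add_one_le_exp _))

theorem prod_rpow_finrank {ι : Type*} [Fintype ι] {m c : ι → ℝ} {n t : ℝ} (ht : 0 < t)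
    (h : ∑ i, c i * m i = n) : ∏ i, (t ^ (m i / 2)) ^ c i = t ^ (n / 2) := by
  rw [← h, Finset.sum_div, Real.rpow_sum_of_pos ht]
  refine Finset.prod_congr rfl fun i _ => ?_
  rw [← Real.rpow_mul ht.le]
  congr 1
  ring

section Gaussian

variable {ι : Type*} [Fintype ι] {E : Type*} [NormedAddCommGroup E] [InnerProductSpace ℝ E]
  [FiniteDimensional ℝ E] [MeasurableSpace E] [BorelSpace E] {H : ι → Type*}
  [∀ i, NormedAddCommGroup (H i)] [∀ i, InnerProductSpace ℝ (H i)]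
  [∀ i, FiniteDimensional ℝ (H i)] [∀ i, MeasurableSpace (H i)] [∀ i, BorelSpace (H i)]

/-- The best constant in the Brascamp-Lieb inequality for centred Gaussian inputs. -/
noncomputable def gaussianConst (B : ∀ i, E →L[ℝ] H i) (c : ι → ℝ) : ℝ≥0∞ :=
  ⨆ (A : ∀ i, H i →ₗ[ℝ] H i) (_ : ∀ i, IsPosDefMap (A i)),
    (∫⁻ x, ∏ i, ENNReal.ofReal (Real.exp (-⟪A i (B i x), B i x⟫)) ^ (c i)) /
      ∏ i, (∫⁻ y, ENNReal.ofReal (Real.exp (-⟪A i y, y⟫))) ^ (c i)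

theorem lintegral_exp_neg_norm_sq_comp {H : Type*} [NormedAddCommGroup H] [InnerProductSpace ℝ H]
    [FiniteDimensional ℝ H] [MeasurableSpace H] [BorelSpace H] {W : H →L[ℝ] H} (hW : W.det ≠ 0) :
    ∫⁻ y, ENNReal.ofReal (Real.exp (-‖W y‖ ^ 2 / 2)) =
      ENNReal.ofReal (|W.det|⁻¹ * (2 * Real.pi) ^ (Module.finrank ℝ H / 2 : ℝ)) := by
  have h := lintegral_comp_linearMap (W := (W : H →ₗ[ℝ] H)) hW
    (f := fun y => ENNReal.ofReal (Real.exp (-‖y‖ ^ 2 / 2))) (by fun_prop)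
  have h1 := lintegral_exp_mul_eq_stdGaussian (E := H) (f := fun _ => 1) measurable_const
  simp only [mul_one, lintegral_const, measure_univ] at h1
  rw [h1] at h
  have hp : 0 < |W.det| := abs_pos.2 hW
  rw [ENNReal.ofReal_mul (by positivity), ← h, ← mul_assoc]
  rw [show LinearMap.det (W : H →ₗ[ℝ] H) = W.det from rfl, ← ENNReal.ofReal_mul (by positivity),
    inv_mul_cancel₀ hp.ne']
  simp

theorem isPosDefMap_adjoint_comp {H : Type*} [NormedAddCommGroup H] [InnerProductSpace ℝ H]
    [FiniteDimensional ℝ H] {W : H →L[ℝ] H} (hW : W.det ≠ 0) :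
    IsPosDefMap ((1 / 2 : ℝ) • (W.adjoint ∘L W : H →L[ℝ] H) : H →ₗ[ℝ] H) := by
  refine ⟨fun x y => ?_, fun x hx => ?_⟩
  · simp [inner_smul_left, inner_smul_right, ContinuousLinearMap.adjoint_inner_left,
      ContinuousLinearMap.adjoint_inner_right]
  · have h : W x ≠ 0 := fun h0 => hx <| by
      have hi := (LinearMap.equivOfDetNeZero (W : H →ₗ[ℝ] H) hW).injective
      exact hi (h0.trans (map_zero _).symm)
    have := norm_pos_iff.2 h
    simp [inner_smul_right, ContinuousLinearMap.adjoint_inner_right]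
    positivity

theorem ofReal_le_gaussianConst {B : ∀ i, E →L[ℝ] H i} {c : ι → ℝ}
    (hsum : ∑ i, c i * (Module.finrank ℝ (H i) : ℝ) = Module.finrank ℝ E) {L : E →L[ℝ] E}
    (hL : L.det ≠ 0) {W : ∀ i, H i →L[ℝ] H i} (hW : ∀ i, IsWhitening (B i ∘L L) (W i)) :
    ENNReal.ofReal (|L.det| * ∏ i, |(W i).det| ^ c i) ≤ gaussianConst B c := by
  have hWd := fun i => (hW i).det_ne_zero
  refine le_trans ?_ (le_iSup₂ (fun i => ((1 / 2 : ℝ) • ((W i).adjoint ∘L W i : H i →L[ℝ] H i) :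
    H i →ₗ[ℝ] H i)) fun i => isPosDefMap_adjoint_comp (hWd i))
  have hA : ∀ i (y : H i), -⟪((1 / 2 : ℝ) • ((W i).adjoint ∘L W i : H i →L[ℝ] H i) :
      H i →ₗ[ℝ] H i) y, y⟫ = -‖W i y‖ ^ 2 / 2 := fun i y => by
    simp [inner_smul_left, ContinuousLinearMap.adjoint_inner_left]
    ring
  simp only [hA]
  have hden : ∏ i, (∫⁻ y, ENNReal.ofReal (Real.exp (-‖W i y‖ ^ 2 / 2))) ^ (c i) =
      ENNReal.ofReal (∏ i, (|(W i).det|⁻¹ * (2 * Real.pi) ^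
        (Module.finrank ℝ (H i) / 2 : ℝ)) ^ c i) := by
    rw [ENNReal.ofReal_prod_of_nonneg fun i _ => by positivity]
    refine Finset.prod_congr rfl fun i _ => ?_
    have := abs_pos.2 (hWd i)
    rw [lintegral_exp_neg_norm_sq_comp (hWd i), ENNReal.ofReal_rpow_of_pos (by positivity)]
  have hD : 0 < ∏ i, (|(W i).det|⁻¹ * (2 * Real.pi) ^
        (Module.finrank ℝ (H i) / 2 : ℝ)) ^ c i := Finset.prod_pos fun i _ => by
    have := abs_pos.2 (hWd i)
    positivity
  rw [hden, ENNReal.le_div_iff_mul_le (Or.inl (by simpa using hD)) (Or.inl ENNReal.ofReal_ne_top),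
    ← ENNReal.ofReal_mul (by positivity)]
  have hreal : (|L.det| * ∏ i, |(W i).det| ^ c i) * ∏ i, (|(W i).det|⁻¹ * (2 * Real.pi) ^
        (Module.finrank ℝ (H i) / 2 : ℝ)) ^ c i =
      |L.det| * (2 * Real.pi) ^ (Module.finrank ℝ E / 2 : ℝ) := by
    rw [← prod_rpow_finrank Real.two_pi_pos hsum, mul_assoc, ← Finset.prod_mul_distrib]
    refine congrArg _ (Finset.prod_congr rfl fun i _ => ?_)
    have := abs_pos.2 (hWd i)
    rw [Real.mul_rpow (by positivity) (by positivity), Real.inv_rpow (by positivity),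
      mul_inv_cancel_left₀ (by positivity)]
  have hnum : ∫⁻ x, ∏ i, ENNReal.ofReal (Real.exp (-‖W i (B i x)‖ ^ 2 / 2)) ^ (c i) =
      ENNReal.ofReal |L.det| * (ENNReal.ofReal ((2 * Real.pi) ^ (Module.finrank ℝ E / 2 : ℝ)) *
        ∫⁻ z, ENNReal.ofReal (Real.exp ((‖z‖ ^ 2 - ∑ i, c i * ‖W i (B i (L z))‖ ^ 2) / 2))
          ∂(stdGaussian E)) := by
    rw [← lintegral_exp_mul_eq_stdGaussian (by fun_prop),
      ← lintegral_comp_linearMap (W := (L : E →ₗ[ℝ] E)) hL (by fun_prop)]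
    congr 1
    refine lintegral_congr fun z => ?_
    rw [← ENNReal.ofReal_mul (by positivity), ← Real.exp_add,
      show -‖z‖ ^ 2 / 2 + (‖z‖ ^ 2 - ∑ i, c i * ‖W i (B i (L z))‖ ^ 2) / 2 =
        ∑ i, -‖W i (B i (L z))‖ ^ 2 / 2 * c i by
          rw [← add_div, neg_add_eq_sub, sub_sub_cancel_left, ← Finset.sum_neg_distrib,
            Finset.sum_div]
          exact Finset.sum_congr rfl fun i _ => by ring,
      Real.exp_sum, ENNReal.ofReal_prod_of_nonneg fun i _ => (Real.exp_pos _).le]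
    refine Finset.prod_congr rfl fun i _ => ?_
    rw [Real.exp_mul, ENNReal.ofReal_rpow_of_pos (Real.exp_pos _)]
    rfl
  have hId : Integrable (fun z => ‖z‖ ^ 2) (stdGaussian E) ∧
      ∫ z, ‖z‖ ^ 2 ∂(stdGaussian E) = Module.finrank ℝ E :=
    integral_norm_sq_stdGaussian (ContinuousLinearMap.id ℝ E) fun w => by
      rw [ContinuousLinearMap.adjoint_id]; rfl
  have hi : ∀ i, Integrable (fun z => ‖W i (B i (L z))‖ ^ 2) (stdGaussian E) ∧
      ∫ z, ‖W i (B i (L z))‖ ^ 2 ∂(stdGaussian E) = Module.finrank ℝ (H i) := fun i =>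
    integral_norm_sq_stdGaussian (W i ∘L (B i ∘L L)) (hW i).norm_adjoint_comp
  have hInt : Integrable (fun z => ∑ i, c i * ‖W i (B i (L z))‖ ^ 2) (stdGaussian E) :=
    integrable_finsetSum _ fun i _ => (hi i).1.const_mul _
  have hge : 1 ≤ ∫⁻ z, ENNReal.ofReal (Real.exp
      ((‖z‖ ^ 2 - ∑ i, c i * ‖W i (B i (L z))‖ ^ 2) / 2)) ∂(stdGaussian E) := by
    refine one_le_lintegral_exp ((hId.1.sub hInt).div_const 2) ?_
    rw [integral_div, integral_sub hId.1 hInt, integral_finsetSum _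
      fun i _ => (hi i).1.const_mul _]
    simp only [integral_const_mul, fun i => (hi i).2, hId.2, hsum, sub_self, zero_div]
  rw [hreal, hnum, ENNReal.ofReal_mul (abs_nonneg _)]
  gcongr
  exact le_mul_of_one_le_right (zero_le) hge

end Gaussian

section Stationary

variable {ι : Type*} [Fintype ι] {E : Type*} [NormedAddCommGroup E] [InnerProductSpace ℝ E]
  [FiniteDimensional ℝ E] {H : ι → Type*}
  [∀ i, NormedAddCommGroup (H i)] [∀ i, InnerProductSpace ℝ (H i)]
  [∀ i, FiniteDimensional ℝ (H i)]

theorem norm_sum_adjoint_sq_le {c : ι → ℝ} (hc : ∀ i, 0 < c i) {T : ∀ i, E →L[ℝ] H i}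
    {W : ∀ i, H i →L[ℝ] H i} (hW : ∀ i, IsWhitening (T i) (W i))
    (h : ∀ u, ∑ i, c i * ‖W i (T i u)‖ ^ 2 ≤ ‖u‖ ^ 2) (w : ∀ i, H i) :
    ‖∑ i, c i • (T i).adjoint (w i)‖ ^ 2 ≤ ∑ i, c i * ‖(T i).adjoint (w i)‖ ^ 2 := by
  have hv : ∀ i, ∃ v, (W i).adjoint v = w i := fun i => by
    have hd : LinearMap.det ((W i).adjoint : H i →ₗ[ℝ] H i) ≠ 0 := by
      change (W i).adjoint.det ≠ 0
      rw [det_adjoint]; exact (hW i).det_ne_zero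
    exact (LinearMap.equivOfDetNeZero _ hd).surjective (w i)
  choose v hv using hv
  set u := ∑ i, c i • (T i).adjoint (w i) with hu
  have h1 : ‖u‖ ^ 2 = ∑ i, c i * ⟪v i, W i (T i u)⟫ := by
    rw [← real_inner_self_eq_norm_sq]
    nth_rewrite 1 [hu]
    rw [sum_inner]
    refine Finset.sum_congr rfl fun i _ => ?_
    rw [real_inner_smul_left, ContinuousLinearMap.adjoint_inner_left, ← hv i,
      ContinuousLinearMap.adjoint_inner_left]
  have h2 : ∑ i, c i * ⟪v i, W i (T i u)⟫ ≤
      ∑ i, (c i * ‖(T i).adjoint (w i)‖ ^ 2 + c i * ‖W i (T i u)‖ ^ 2) / 2 := by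
    refine Finset.sum_le_sum fun i _ => ?_
    rw [← hv i, hW i, ← mul_add, mul_div_assoc]
    refine mul_le_mul_of_nonneg_left ?_ (hc i).le
    have := real_inner_le_norm (v i) (W i (T i u))
    nlinarith [sq_nonneg (‖v i‖ - ‖W i (T i u)‖)]
  rw [← Finset.sum_div, Finset.sum_add_distrib] at h2
  linarith [h u]

/-- The Gaussian Brascamp-Lieb functional, in terms of a linear change of variables. -/
noncomputable def functional (B : ∀ i, E →L[ℝ] H i) (c : ι → ℝ) (L : E →L[ℝ] E) : ℝ :=
  |L.det| * ∏ i, (gramNorm (B i ∘L L) ^ c i)⁻¹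

theorem surjective_comp {F : Type*} [NormedAddCommGroup F] [InnerProductSpace ℝ F]
    {B : E →L[ℝ] F} (hB : Function.Surjective B) {L : E →L[ℝ] E} (hL : L.det ≠ 0) :
    Function.Surjective (B ∘L L) :=
  hB.comp (LinearMap.equivOfDetNeZero (L : E →ₗ[ℝ] E) hL).surjective

theorem functional_pos {B : ∀ i, E →L[ℝ] H i} (hB : ∀ i, Function.Surjective (B i)) (c : ι → ℝ)
    {L : E →L[ℝ] E} (hL : L.det ≠ 0) : 0 < functional B c L := by
  refine mul_pos (abs_pos.2 hL) (Finset.prod_pos fun i _ => ?_)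
  have := gramNorm_pos (surjective_comp (hB i) hL)
  positivity

theorem functional_eq_of_isWhitening {B : ∀ i, E →L[ℝ] H i} (c : ι → ℝ)
    {L : E →L[ℝ] E} {W : ∀ i, H i →L[ℝ] H i} (hW : ∀ i, IsWhitening (B i ∘L L) (W i)) :
    functional B c L = |L.det| * ∏ i, |(W i).det| ^ c i := by
  refine congrArg _ (Finset.prod_congr rfl fun i _ => ?_)
  have h := (hW i).abs_det_mul_gramNorm
  have h0 := abs_pos.2 (hW i).det_ne_zero
  have : gramNorm (B i ∘L L) = |(W i).det|⁻¹ := eq_inv_of_mul_eq_one_right h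
  rw [this, Real.inv_rpow h0.le, inv_inv]

theorem functional_smul {B : ∀ i, E →L[ℝ] H i} (hB : ∀ i, Function.Surjective (B i)) {c : ι → ℝ}
    (hsum : ∑ i, c i * (Module.finrank ℝ (H i) : ℝ) = Module.finrank ℝ E) {L : E →L[ℝ] E}
    (hL : L.det ≠ 0) {r : ℝ} (hr : 0 < r) : functional B c (r • L) = functional B c L := by
  have hd : (r • L).det = r ^ Module.finrank ℝ E * L.det := LinearMap.det_smul _ _
  have hg : ∀ i, gramNorm (B i ∘L (r • L)) = r ^ Module.finrank ℝ (H i) * gramNorm (B i ∘L L) :=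
    fun i => by
      rw [ContinuousLinearMap.comp_smul, gramNorm_smul, abs_of_pos hr]
  have hp : ∏ i, (r ^ Module.finrank ℝ (H i)) ^ c i = r ^ Module.finrank ℝ E := by
    have h := prod_rpow_finrank (m := fun i => (Module.finrank ℝ (H i) : ℝ)) (pow_pos hr 2) hsum
    have e : ∀ m : ℕ, (r ^ 2) ^ (m / 2 : ℝ) = r ^ m := fun m => by
      rw [← Real.rpow_natCast r 2, ← Real.rpow_mul hr.le, ← Real.rpow_natCast r m]
      congr 1; push_cast; ring
    simpa only [e] using h
  have hg0 : ∀ i, 0 ≤ gramNorm (B i ∘L L) := fun i =>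
    (gramNorm_pos (surjective_comp (hB i) hL)).le
  simp only [functional, hd, hg, abs_mul, abs_of_pos (pow_pos hr _)]
  simp only [Real.mul_rpow (pow_pos hr _).le (hg0 _), mul_inv, Finset.prod_mul_distrib]
  rw [Finset.prod_inv_distrib, hp]
  field_simp

theorem continuous_gramNorm_comp {F : Type*} [NormedAddCommGroup F] [InnerProductSpace ℝ F]
    [FiniteDimensional ℝ F] (B : E →L[ℝ] F) :
    Continuous fun L : E →L[ℝ] E => gramNorm (B ∘L L) := by
  simp only [gramNorm_eq_sqrt]
  refine Real.continuous_sqrt.comp (ContinuousLinearMap.continuous_det.comp ?_)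
  have h : Continuous fun L : E →L[ℝ] E => B ∘L L := by fun_prop
  exact h.clm_comp ((ContinuousLinearMap.adjoint (𝕜 := ℝ)).continuous.comp h)

theorem exists_isMax_functional {B : ∀ i, E →L[ℝ] H i} (hB : ∀ i, Function.Surjective (B i))
    {c : ι → ℝ} (hc : ∀ i, 0 < c i) {C δ : ℝ} (hδ : 0 < δ)
    (hC : ∀ L, L.det ≠ 0 → functional B c L ≤ C) {L₀ : E →L[ℝ] E} (hL₀ : L₀.det ≠ 0)
    (hL₀' : ‖L₀‖ ≤ 1) :
    ∃ L : E →L[ℝ] E, ‖L‖ ≤ 1 ∧ L.det ≠ 0 ∧ ∀ L' : E →L[ℝ] E, ‖L'‖ ≤ 1 → L'.det ≠ 0 →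
      functional B c L' * |L'.det| ^ δ ≤ functional B c L * |L.det| ^ δ := by
  have hC0 : 0 < C := (functional_pos hB c hL₀).trans_le (hC _ hL₀)
  have hd0 := abs_pos.2 hL₀
  have hF0 := functional_pos hB c hL₀
  set y := functional B c L₀ * |L₀.det| ^ δ / C with hy
  have hy0 : 0 < y := by positivity
  set η := y ^ δ⁻¹ with hη
  have hη0 : 0 < η := by positivity
  have hηδ : η ^ δ = y := Real.rpow_inv_rpow hy0.le hδ.ne'
  set K : Set (E →L[ℝ] E) := Metric.closedBall 0 1 ∩ {L | η ≤ |L.det|} with hK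
  have hcd : Continuous fun L : E →L[ℝ] E => |L.det| :=
    ContinuousLinearMap.continuous_det.abs
  have : ProperSpace (E →L[ℝ] E) := FiniteDimensional.proper ℝ _
  have hKc : IsCompact K :=
    (isCompact_closedBall _ _).inter_right (isClosed_le continuous_const hcd)
  have hdK : ∀ L ∈ K, L.det ≠ 0 := fun L hL => abs_pos.1 (hη0.trans_le hL.2)
  have hL₀K : L₀ ∈ K := by
    refine ⟨by simpa using hL₀', ?_⟩
    refine (Real.rpow_le_rpow_iff hη0.le hd0.le hδ).1 ?_
    rw [hηδ, hy, div_le_iff₀ hC0, mul_comm]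
    exact mul_le_mul_of_nonneg_left (hC _ hL₀) (by positivity)
  have hcont : ContinuousOn (fun L => functional B c L * |L.det| ^ δ) K := by
    refine ContinuousOn.mul (hcd.continuousOn.mul (continuousOn_finsetProd _ fun i _ => ?_))
      (hcd.continuousOn.rpow_const fun L hL => Or.inr hδ.le)
    refine ((continuous_gramNorm_comp (B i)).continuousOn.rpow_const
      fun L hL => Or.inr (hc i).le).inv₀ fun L hL => ?_
    have := gramNorm_pos (surjective_comp (hB i) (hdK L hL))
    positivity
  obtain ⟨L, hLK, hmax⟩ := hKc.exists_isMaxOn ⟨L₀, hL₀K⟩ hcont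
  refine ⟨L, by simpa using hLK.1, hdK L hLK, fun L' hL' hd' => ?_⟩
  rcases le_or_gt η |L'.det| with h | h
  · exact hmax ⟨by simpa using hL', h⟩
  · refine le_trans ?_ (hmax hL₀K)
    calc functional B c L' * |L'.det| ^ δ ≤ C * η ^ δ := by
          gcongr
          exact hC _ hd'
      _ = functional B c L₀ * |L₀.det| ^ δ := by rw [hηδ, hy]; field_simp

theorem sum_norm_sq_le_of_isMax {B : ∀ i, E →L[ℝ] H i} (hB : ∀ i, Function.Surjective (B i))
    {c : ι → ℝ} (hc : ∀ i, 0 < c i) {δ : ℝ} (hδ : 0 < δ) {L : E →L[ℝ] E} (hL : ‖L‖ ≤ 1)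
    (hd : L.det ≠ 0) (hmax : ∀ L' : E →L[ℝ] E, ‖L'‖ ≤ 1 → L'.det ≠ 0 →
      functional B c L' * |L'.det| ^ δ ≤ functional B c L * |L.det| ^ δ)
    {W : ∀ i, H i →L[ℝ] H i} (hW : ∀ i, IsWhitening (B i ∘L L) (W i)) (u : E) :
    ∑ i, c i * ‖W i (B i (L u))‖ ^ 2 ≤ (1 + δ) * ‖u‖ ^ 2 := by
  wlog hu : ‖u‖ = 1 generalizing u
  · rcases eq_or_ne u 0 with rfl | h0
    · simp
    have h0' := norm_pos_iff.2 h0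
    have h := this (‖u‖⁻¹ • u) (by rw [norm_smul, norm_inv, norm_norm, inv_mul_cancel₀ h0'.ne'])
    simp only [map_smul, norm_smul, norm_inv, norm_norm, mul_pow] at h
    have h2 : ∑ i, c i * ((‖u‖⁻¹) ^ 2 * ‖W i (B i (L u))‖ ^ 2) =
        (‖u‖⁻¹) ^ 2 * ∑ i, c i * ‖W i (B i (L u))‖ ^ 2 := by
      rw [Finset.mul_sum]
      exact Finset.sum_congr rfl fun i _ => by ring
    rw [h2, mul_left_comm] at h
    exact le_of_mul_le_mul_left h (by positivity)
  set b := fun i => ‖W i (B i (L u))‖ ^ 2 with hb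
  have hb1 : ∀ i, b i ≤ 1 := fun i => by
    have := (hW i).norm_apply_le u
    rw [hu] at this
    exact pow_le_one₀ (norm_nonneg _) this
  have hb0 : ∀ i, 0 ≤ b i := fun i => by positivity
  set S := ∑ i, c i * b i with hS
  have key : ∀ s : ℝ, 0 < s → s < 1 → S * (1 - s / 2) ≤ (1 + δ) / (1 - s) := by
    intro s hs0 hs1
    set Q := ContinuousLinearMap.id ℝ E + (-s • innerSL ℝ u).smulRight u with hQ
    have hQd : Q.det = 1 - s := by
      rw [hQ, det_id_add_smulRight, hu]; ring
    have hLQ : (L ∘L Q).det = L.det * Q.det := LinearMap.det_comp _ _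
    have hs1' : 0 < 1 - s := by linarith
    have hτb : ∀ i, (2 * s - s ^ 2) * b i < 1 := fun i => by
      have h1 : 2 * s - s ^ 2 < 1 := by nlinarith
      have h2 : 0 < 2 * s - s ^ 2 := by nlinarith
      nlinarith [hb1 i, hb0 i]
    have h1 := hmax (L ∘L Q) ((ContinuousLinearMap.opNorm_comp_le _ _).trans
      (mul_le_one₀ hL (norm_nonneg _) (norm_id_sub_smulRight_le hu hs0.le hs1.le)))
      (by rw [hLQ, hQd]; exact mul_ne_zero hd hs1'.ne')
    have hg : ∀ i, gramNorm (B i ∘L (L ∘L Q)) =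
        gramNorm (B i ∘L L) * √(1 - (2 * s - s ^ 2) * b i) := fun i =>
      gramNorm_comp_perturbation (hW i) hu (hτb i)
    have hfun : functional B c (L ∘L Q) = functional B c L * ((1 - s) *
        ∏ i, (√(1 - (2 * s - s ^ 2) * b i) ^ c i)⁻¹) := by
      simp only [functional, hg, hLQ, hQd, abs_mul, abs_of_pos hs1']
      rw [mul_mul_mul_comm, ← Finset.prod_mul_distrib]
      refine congrArg _ (Finset.prod_congr rfl fun i _ => ?_)
      rw [Real.mul_rpow (gramNorm_pos (surjective_comp (hB i) hd)).le (Real.sqrt_nonneg _),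
        mul_inv]
    have hF := functional_pos hB c hd
    have hd' := abs_pos.2 hd
    rw [hfun, hLQ, hQd, abs_mul, abs_of_pos hs1', Real.mul_rpow hd'.le hs1'.le] at h1
    have hsq : ∀ i, √(1 - (2 * s - s ^ 2) * b i) ≤ Real.exp (-((2 * s - s ^ 2) * b i / 2)) :=
      fun i => by
        refine Real.sqrt_le_iff.2 ⟨(Real.exp_pos _).le, ?_⟩
        rw [← Real.exp_nat_mul]
        refine le_trans (le_of_eq ?_) (Real.add_one_le_exp _)
        push_cast; ring
    have hsq0 : ∀ i, 0 < √(1 - (2 * s - s ^ 2) * b i) := fun i =>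
      Real.sqrt_pos.2 (by linarith [hτb i])
    have h2 : (1 - s) ^ (1 + δ) ≤ ∏ i, √(1 - (2 * s - s ^ 2) * b i) ^ c i := by
      have hP : 0 < ∏ i, √(1 - (2 * s - s ^ 2) * b i) ^ c i :=
        Finset.prod_pos fun i _ => Real.rpow_pos_of_pos (hsq0 i) _
      rw [Finset.prod_inv_distrib] at h1
      rw [Real.rpow_add hs1', Real.rpow_one, ← div_le_one₀ hP]
      refine le_of_mul_le_mul_left (le_trans (le_of_eq ?_) (h1.trans_eq (mul_one _).symm))
        (by positivity)
      ring
    have h3 : ∏ i, √(1 - (2 * s - s ^ 2) * b i) ^ c i ≤ Real.exp (-(s * (S * (1 - s / 2)))) := by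
      have e : -(s * (S * (1 - s / 2))) = ∑ i, -((2 * s - s ^ 2) * b i / 2) * c i := by
        rw [hS, Finset.sum_mul, Finset.mul_sum, ← Finset.sum_neg_distrib]
        exact Finset.sum_congr rfl fun i _ => by ring
      rw [e, Real.exp_sum]
      refine Finset.prod_le_prod (fun i _ => by positivity) fun i _ => ?_
      rw [Real.exp_mul]
      exact Real.rpow_le_rpow (hsq0 i).le (hsq i) (hc i).le
    have h4 := Real.log_le_log (by positivity) (h2.trans h3)
    rw [Real.log_exp, Real.log_rpow hs1'] at h4
    have h5 := Real.one_sub_inv_le_log_of_pos hs1'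
    have h6 : s * (S * (1 - s / 2)) ≤ s * ((1 + δ) / (1 - s)) := by
      have e : s * ((1 + δ) / (1 - s)) = -((1 + δ) * (1 - (1 - s)⁻¹)) := by
        field_simp; ring
      rw [e]
      nlinarith
    exact le_of_mul_le_mul_left h6 hs0
  have hl : Filter.Tendsto (fun s : ℝ => S * (1 - s / 2)) (nhdsWithin 0 (Set.Ioi 0)) (nhds S) := by
    have : Continuous fun s : ℝ => S * (1 - s / 2) := by fun_prop
    simpa using (this.tendsto 0).mono_left nhdsWithin_le_nhds
  have hr : Filter.Tendsto (fun s : ℝ => (1 + δ) / (1 - s)) (nhdsWithin 0 (Set.Ioi 0))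
      (nhds (1 + δ)) := by
    have : ContinuousAt (fun s : ℝ => (1 + δ) / (1 - s)) 0 :=
      continuousAt_const.div (by fun_prop) (by simp)
    simpa using this.tendsto.mono_left nhdsWithin_le_nhds
  rw [hu, one_pow, mul_one]
  refine le_of_tendsto_of_tendsto hl hr ?_
  filter_upwards [Ioo_mem_nhdsGT (zero_lt_one' ℝ)] with s hs using key s hs.1 hs.2

end Stationary

section Bound

variable {ι : Type*} [Fintype ι] {E : Type*} [NormedAddCommGroup E] [InnerProductSpace ℝ E]
  [FiniteDimensional ℝ E] [MeasurableSpace E] [BorelSpace E] {H : ι → Type*}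
  [∀ i, NormedAddCommGroup (H i)] [∀ i, InnerProductSpace ℝ (H i)]
  [∀ i, FiniteDimensional ℝ (H i)] [∀ i, MeasurableSpace (H i)] [∀ i, BorelSpace (H i)]

theorem lintegral_comp_stdGaussian_le {H : Type*} [NormedAddCommGroup H] [InnerProductSpace ℝ H]
    [FiniteDimensional ℝ H] [MeasurableSpace H] [BorelSpace H] {T : E →L[ℝ] H} {W : H →L[ℝ] H}
    (hW : IsWhitening T W) {f : H → ℝ≥0∞} (hf : Measurable f) :
    ∫⁻ z, f (T z) ∂(stdGaussian E) ≤
      ENNReal.ofReal ((2 * Real.pi) ^ (-(Module.finrank ℝ H / 2 : ℝ)) * |W.det|) * ∫⁻ y, f y := by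
  set V := (LinearMap.equivOfDetNeZero (W : H →ₗ[ℝ] H) hW.det_ne_zero).symm with hV
  have hVW : ∀ y, V (W y) = y := fun y =>
    (LinearMap.equivOfDetNeZero (W : H →ₗ[ℝ] H) hW.det_ne_zero).symm_apply_apply y
  have hVm : Measurable V := (LinearMap.continuous_of_finiteDimensional V.toLinearMap).measurable
  have hfV : Measurable fun y => f (V y) := hf.comp hVm
  have h1 : ∫⁻ z, f (T z) ∂(stdGaussian E) = ∫⁻ y, f (V y) ∂(stdGaussian H) := by
    rw [← map_stdGaussian_of_norm_adjoint (W ∘L T) hW.norm_adjoint_comp,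
      lintegral_map hfV (by fun_prop)]
    exact lintegral_congr fun z => by simp [hVW]
  have h2 := lintegral_comp_linearMap (W := (W : H →ₗ[ℝ] H)) hW.det_ne_zero hfV
  have h3 : ENNReal.ofReal |W.det| * ∫⁻ y, f y = ∫⁻ y, f (V y) := by
    rw [← show ∫⁻ y, f (V ((W : H →ₗ[ℝ] H) y)) = ∫⁻ y, f y from
      lintegral_congr fun y => by simp [hVW]]
    exact h2
  rw [h1, lintegral_stdGaussian hfV, ENNReal.ofReal_mul (by positivity), mul_assoc, h3]
  gcongr with y
  refine mul_le_of_le_one_left zero_le ?_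
  rw [ENNReal.ofReal_le_one, Real.exp_le_one_iff]
  have := sq_nonneg ‖y‖
  linarith

theorem lintegral_exp_mul_prod_le {B : ∀ i, E →L[ℝ] H i} {c : ι → ℝ} (hc : ∀ i, 0 < c i)
    {L : E →L[ℝ] E} (hL : L.det ≠ 0) {W : ∀ i, H i →L[ℝ] H i}
    (hW : ∀ i, IsWhitening (B i ∘L L) (W i))
    (h : ∀ u, ∑ i, c i * ‖W i (B i (L u))‖ ^ 2 ≤ ‖u‖ ^ 2) {δ : ℝ}
    (hδ : ∀ z, ‖z‖ ^ 2 ≤ δ * ‖L z‖ ^ 2) {g : ∀ i, H i → ℝ} (hg : ∀ i, ∃ M, IsTame 0 M (g i)) :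
    ∫⁻ x, ENNReal.ofReal (Real.exp (-(δ * ‖x‖ ^ 2) / 2)) *
        ∏ i, ENNReal.ofReal (g i (B i x)) ^ c i ≤
      ENNReal.ofReal (|L.det| * (2 * Real.pi) ^ (Module.finrank ℝ E / 2 : ℝ) *
        ∏ i, ((2 * Real.pi) ^ (-(Module.finrank ℝ (H i) / 2 : ℝ)) * |(W i).det|) ^ c i) *
        ∏ i, (∫⁻ y, ENNReal.ofReal (g i y)) ^ c i := by
  have hgm : ∀ i, Measurable (g i) := fun i => (hg i).choose_spec.measurable
  have hm : Measurable fun x => ∏ i, ENNReal.ofReal (g i (B i x)) ^ c i := by fun_prop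
  have hmL : Measurable fun z => ∏ i, ENNReal.ofReal (g i (B i (L z))) ^ c i := by fun_prop
  rw [← lintegral_comp_linearMap (W := (L : E →ₗ[ℝ] E)) hL (by fun_prop)]
  have h1 : ∫⁻ z, ENNReal.ofReal (Real.exp (-(δ * ‖L z‖ ^ 2) / 2)) *
        ∏ i, ENNReal.ofReal (g i (B i (L z))) ^ c i ≤
      ∫⁻ z, ENNReal.ofReal (Real.exp (-‖z‖ ^ 2 / 2)) *
        ∏ i, ENNReal.ofReal (g i (B i (L z))) ^ c i := by
    gcongr with z
    exact hδ z
  have h2 := lintegral_prod_le_of_isTame hc (fun i => B i ∘L L)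
    (norm_sum_adjoint_sq_le hc hW h) hg
  have h3 : ∏ i, (∫⁻ z, ENNReal.ofReal (g i ((B i ∘L L) z)) ∂(stdGaussian E)) ^ c i ≤
      ∏ i, (ENNReal.ofReal ((2 * Real.pi) ^ (-(Module.finrank ℝ (H i) / 2 : ℝ)) * |(W i).det|) *
        ∫⁻ y, ENNReal.ofReal (g i y)) ^ c i := by
    refine Finset.prod_le_prod' fun i _ => ENNReal.rpow_le_rpow ?_ (hc i).le
    exact lintegral_comp_stdGaussian_le (hW i) (f := fun y => ENNReal.ofReal (g i y))
      (by have := hgm i; fun_prop)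
  have h4 : ∏ i, (ENNReal.ofReal ((2 * Real.pi) ^ (-(Module.finrank ℝ (H i) / 2 : ℝ)) *
        |(W i).det|) * ∫⁻ y, ENNReal.ofReal (g i y)) ^ c i =
      ENNReal.ofReal (∏ i, ((2 * Real.pi) ^ (-(Module.finrank ℝ (H i) / 2 : ℝ)) *
        |(W i).det|) ^ c i) * ∏ i, (∫⁻ y, ENNReal.ofReal (g i y)) ^ c i := by
    rw [ENNReal.ofReal_prod_of_nonneg fun i _ => by positivity, ← Finset.prod_mul_distrib]
    refine Finset.prod_congr rfl fun i _ => ?_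
    rw [ENNReal.mul_rpow_of_nonneg _ _ (hc i).le,
      ENNReal.ofReal_rpow_of_nonneg (by positivity) (hc i).le]
  have h5 := (h2.trans h3).trans_eq h4
  rw [lintegral_exp_mul_eq_stdGaussian hmL] at h1
  calc _ ≤ ENNReal.ofReal |L.det| * (ENNReal.ofReal ((2 * Real.pi) ^ (Module.finrank ℝ E / 2 : ℝ)) *
        (ENNReal.ofReal (∏ i, ((2 * Real.pi) ^ (-(Module.finrank ℝ (H i) / 2 : ℝ)) *
        |(W i).det|) ^ c i) * ∏ i, (∫⁻ y, ENNReal.ofReal (g i y)) ^ c i)) := by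
        refine mul_le_mul_right (h1.trans (mul_le_mul_right h5 _)) _
    _ = _ := by
      rw [ENNReal.ofReal_mul (by positivity), ENNReal.ofReal_mul (by positivity)]
      ring

end Bound

/-- The loss in the regularised Brascamp-Lieb inequality with exponents `c / (1 + δ)`. -/
noncomputable def lossFactor (n : ℕ) (p C δ : ℝ) : ℝ :=
  Real.exp ((δ * Real.log (2 * Real.pi) - δ * Real.log δ) * (n / (2 * (1 + δ)))) *
    (p / C) ^ (-(n / (1 + δ))) * C ^ (1 / (1 + δ))

theorem mul_prod_le_lossFactor {ι : Type*} [Fintype ι] {n : ℕ} {m : ι → ℕ} {c w : ι → ℝ}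
    {d p C δ : ℝ} (hsum : ∑ i, c i * (m i : ℝ) = n) (hd : 0 < d) (hd1 : d ≤ 1)
    (hw : ∀ i, 0 < w i) (hp : 0 < p) (hδ : 0 < δ) (hC : d * ∏ i, w i ^ c i ≤ C)
    (hpC : p ≤ C * d ^ δ) {r : ℝ} (hr : r = (√δ * d)⁻¹) :
    r ^ n * d * (2 * Real.pi) ^ (n / 2 : ℝ) *
      ∏ i, ((2 * Real.pi) ^ (-(m i / 2 : ℝ)) * (r⁻¹ ^ m i * w i)) ^ (c i / (1 + δ)) ≤
    lossFactor n p C δ := by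
  rw [lossFactor]
  have hT : 0 < 2 * Real.pi := by positivity
  generalize 2 * Real.pi = T at hT ⊢
  have hr0 : 0 < r := by rw [hr]; positivity
  have hP : 0 < ∏ i, w i ^ c i := Finset.prod_pos fun i _ => Real.rpow_pos_of_pos (hw i) _
  have hC0 : 0 < C := lt_of_lt_of_le (by positivity) hC
  have hf : ∀ i, 0 < T ^ (-(m i / 2 : ℝ)) * (r⁻¹ ^ m i * w i) := fun i => by
    have := hw i
    positivity
  have hf' : 0 < ∏ i, (T ^ (-(m i / 2 : ℝ)) * (r⁻¹ ^ m i * w i)) ^ (c i / (1 + δ)) :=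
    Finset.prod_pos fun i _ => Real.rpow_pos_of_pos (hf i) _
  have hlr : Real.log r = -(Real.log δ / 2 + Real.log d) := by
    rw [hr, Real.log_inv, Real.log_mul (by positivity) hd.ne', Real.log_sqrt hδ.le]
  have hlf : ∀ i, Real.log ((T ^ (-(m i / 2 : ℝ)) * (r⁻¹ ^ m i * w i)) ^
      (c i / (1 + δ))) = -(Real.log T / 2 + Real.log r) / (1 + δ) * (c i * m i) +
        c i * Real.log (w i) / (1 + δ) := fun i => by
    have := hw i
    rw [Real.log_rpow (hf i), Real.log_mul (by positivity) (by positivity),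
      Real.log_rpow (by positivity), Real.log_mul (by positivity) (by positivity), Real.log_pow,
      Real.log_inv]
    field_simp
    ring
  have h1 : Real.log d + ∑ i, c i * Real.log (w i) ≤ Real.log C := by
    have h := Real.log_le_log (by positivity) hC
    rw [Real.log_mul hd.ne' hP.ne', Real.log_prod fun i _ =>
      (Real.rpow_pos_of_pos (hw i) _).ne'] at h
    simpa only [fun i => Real.log_rpow (hw i) (c i)] using h
  have h2 : Real.log p - Real.log C ≤ δ * Real.log d := by
    have h := Real.log_le_log hp hpC
    rw [Real.log_mul hC0.ne' (by positivity), Real.log_rpow hd] at h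
    linarith
  have h3 : Real.log d ≤ 0 := Real.log_nonpos hd.le hd1
  rw [← Real.log_le_log_iff (by positivity) (by positivity),
    Real.log_mul (by positivity) hf'.ne', Real.log_mul (by positivity) (by positivity),
    Real.log_mul (by positivity) hd.ne', Real.log_pow, Real.log_rpow (by positivity),
    Real.log_prod fun i _ => (Real.rpow_pos_of_pos (hf i) _).ne', Finset.sum_congr rfl
    fun i _ => hlf i, Finset.sum_add_distrib, ← Finset.mul_sum, hsum, ← Finset.sum_div,
    Real.log_mul (by positivity) (by positivity), Real.log_mul (by positivity) (by positivity),
    Real.log_exp, Real.log_rpow (by positivity), Real.log_rpow hC0,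
    Real.log_div hp.ne' hC0.ne', hlr]
  generalize Real.log d = ld at *
  generalize Real.log p = lp at *
  generalize Real.log C = lC at *
  generalize Real.log T = l2 at *
  generalize Real.log δ = lδ at *
  generalize ∑ i, c i * Real.log (w i) = S at *
  have hn : (0 : ℝ) ≤ n := Nat.cast_nonneg n
  have h4 : n * (lp - lC) ≤ n * (δ * ld) := mul_le_mul_of_nonneg_left h2 hn
  have h5 : δ * ld ≤ 0 := mul_nonpos_of_nonneg_of_nonpos hδ.le h3
  rw [← sub_nonneg]
  have e : (δ * l2 - δ * lδ) * (n / (2 * (1 + δ))) + -(n / (1 + δ)) * (lp - lC) +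
      1 / (1 + δ) * lC - (n * -(lδ / 2 + ld) + ld + n / 2 * l2 +
        (-(l2 / 2 + -(lδ / 2 + ld)) / (1 + δ) * n + S / (1 + δ))) =
      ((n * (δ * ld) - n * (lp - lC)) + (lC - (ld + S)) - δ * ld) / (1 + δ) := by
    field_simp
    ring
  rw [e]
  refine div_nonneg ?_ (by positivity)
  linarith

theorem tendsto_lossFactor (n : ℕ) {p q C : ℝ} (hp : 0 < p) (hq : 0 < q) (hC : 0 < C) :
    Filter.Tendsto (fun δ : ℝ => lossFactor n (p * q ^ δ) C δ) (nhds 0)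
      (nhds ((p / C) ^ (-(n : ℝ)) * C)) := by
  have hcont : ContinuousAt (fun δ : ℝ => lossFactor n (p * q ^ δ) C δ) 0 := by
    have h1 : ContinuousAt (fun δ : ℝ => 1 + δ) 0 := by fun_prop
    have h2 : ContinuousAt (fun δ : ℝ => q ^ δ) 0 :=
      (Real.continuous_const_rpow hq.ne').continuousAt
    unfold lossFactor
    refine ContinuousAt.mul (ContinuousAt.mul (Real.continuous_exp.continuousAt.comp
      (ContinuousAt.mul ?_ ?_)) ?_) ?_
    · exact (by fun_prop : ContinuousAt (fun δ : ℝ => δ * Real.log (2 * Real.pi)) 0).sub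
        Real.continuous_mul_log.continuousAt
    · exact continuousAt_const.div (by fun_prop) (by norm_num)
    · refine ContinuousAt.rpow (by fun_prop) ((continuousAt_const.div h1 (by norm_num)).neg) ?_
      left; simp; constructor <;> positivity
    · exact continuousAt_const.rpow (continuousAt_const.div h1 (by norm_num)) (Or.inl hC.ne')
  have h := hcont.tendsto
  simpa [lossFactor] using h

section Main

variable {ι : Type*} [Fintype ι] {E : Type*} [NormedAddCommGroup E] [InnerProductSpace ℝ E]
  [FiniteDimensional ℝ E] [MeasurableSpace E] [BorelSpace E] {H : ι → Type*}
  [∀ i, NormedAddCommGroup (H i)] [∀ i, InnerProductSpace ℝ (H i)]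
  [∀ i, FiniteDimensional ℝ (H i)] [∀ i, MeasurableSpace (H i)] [∀ i, BorelSpace (H i)]
  {B : ∀ i, E →L[ℝ] H i} {c : ι → ℝ}

theorem lintegral_exp_mul_prod_le_lossFactor (hB : ∀ i, Function.Surjective (B i))
    (hc : ∀ i, 0 < c i)
    (hsum : ∑ i, c i * (Module.finrank ℝ (H i) : ℝ) = Module.finrank ℝ E) {C δ : ℝ} (hδ : 0 < δ)
    (hC : ∀ L, L.det ≠ 0 → functional B c L ≤ C) {L₀ : E →L[ℝ] E} (hL₀ : L₀.det ≠ 0)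
    (hL₀' : ‖L₀‖ ≤ 1) {g : ∀ i, H i → ℝ} (hg : ∀ i, ∃ M, IsTame 0 M (g i)) :
    ∫⁻ x, ENNReal.ofReal (Real.exp (-(δ * ‖x‖ ^ 2) / 2)) *
        ∏ i, ENNReal.ofReal (g i (B i x)) ^ (c i / (1 + δ)) ≤
      ENNReal.ofReal (lossFactor (Module.finrank ℝ E) (functional B c L₀ * |L₀.det| ^ δ) C δ) *
        ∏ i, (∫⁻ y, ENNReal.ofReal (g i y)) ^ (c i / (1 + δ)) := by
  obtain ⟨L, hL1, hLd, hmax⟩ := exists_isMax_functional hB hc hδ hC hL₀ hL₀'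
  have hd := abs_pos.2 hLd
  choose W hW using fun i => exists_isWhitening (surjective_comp (hB i) hLd)
  have hst := sum_norm_sq_le_of_isMax hB hc hδ hL1 hLd hmax hW
  set r := (√δ * |L.det|)⁻¹ with hr
  have hr0 : 0 < r := by positivity
  have hrd : (r • L).det = r ^ Module.finrank ℝ E * L.det := LinearMap.det_smul _ _
  have hWd : ∀ i, (r⁻¹ • W i).det = r⁻¹ ^ Module.finrank ℝ (H i) * (W i).det := fun i =>
    LinearMap.det_smul _ _
  have h := lintegral_exp_mul_prod_le (B := B) (c := fun i => c i / (1 + δ))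
    (fun i => div_pos (hc i) (by linarith)) (L := r • L) (W := fun i => r⁻¹ • W i)
    (by rw [hrd]; exact mul_ne_zero (pow_pos hr0 _).ne' hLd)
    (fun i => by rw [ContinuousLinearMap.comp_smul]; exact (hW i).smul hr0.ne')
    (fun u => by
      have e : ∀ i, (r⁻¹ • W i) (B i ((r • L) u)) = W i (B i (L u)) := fun i => by
        simp [smul_smul, hr0.ne']
      simp only [e]
      have h := hst u
      rw [← div_le_iff₀' (by linarith), Finset.sum_div] at h
      refine le_trans (le_of_eq (Finset.sum_congr rfl fun i _ => by ring)) h)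
    (δ := δ) (fun z => by
      have h1 := abs_det_mul_norm_le hL1 z
      have h2 := pow_le_pow_left₀ (by positivity) h1 2
      have e : δ * ‖(r • L) z‖ ^ 2 = ‖L z‖ ^ 2 / |L.det| ^ 2 := by
        rw [smul_apply, norm_smul, Real.norm_of_nonneg hr0.le, mul_pow, hr,
          inv_pow, mul_pow, Real.sq_sqrt hδ.le]
        field_simp
      rw [e, le_div_iff₀ (by positivity)]
      linarith) hg
  refine h.trans (mul_le_mul_left (ENNReal.ofReal_le_ofReal ?_) _)
  have hcW := hC L hLd
  rw [functional_eq_of_isWhitening c hW] at hcW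
  refine le_trans (le_of_eq ?_) (mul_prod_le_lossFactor hsum hd (abs_det_le_one hL1)
    (fun i => abs_pos.2 (hW i).det_ne_zero)
    (mul_pos (functional_pos hB c hL₀) (Real.rpow_pos_of_pos (abs_pos.2 hL₀) _)) hδ hcW
    ((hmax L₀ hL₀' hL₀).trans (mul_le_mul_of_nonneg_right (hC L hLd) (by positivity))) hr)
  simp only [hrd, hWd, abs_mul, abs_of_pos (pow_pos hr0 _), abs_of_pos (pow_pos (inv_pos.2 hr0) _)]

theorem lintegral_prod_le_of_functional_le (hB : ∀ i, Function.Surjective (B i))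
    (hc : ∀ i, 0 < c i)
    (hsum : ∑ i, c i * (Module.finrank ℝ (H i) : ℝ) = Module.finrank ℝ E) {C : ℝ}
    (hC : ∀ L, L.det ≠ 0 → functional B c L ≤ C) {L₀ : E →L[ℝ] E} (hL₀ : L₀.det ≠ 0)
    {g : ∀ i, H i → ℝ} (hg : ∀ i, ∃ M, IsTame 0 M (g i)) {a : ι → ℝ} (ha : ∀ i, 0 ≤ a i)
    (hga : ∀ i, ∫⁻ y, ENNReal.ofReal (g i y) = ENNReal.ofReal (a i)) :
    ∫⁻ x, ∏ i, ENNReal.ofReal (g i (B i x)) ^ c i ≤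
      ENNReal.ofReal ((functional B c L₀ / C) ^ (-(Module.finrank ℝ E : ℝ)) * C *
        ∏ i, a i ^ c i) := by
  wlog hL₀' : ‖L₀‖ ≤ 1 generalizing L₀
  · have hr : 0 < ‖L₀‖⁻¹ := inv_pos.2 (by linarith)
    have hd : (‖L₀‖⁻¹ • L₀).det = ‖L₀‖⁻¹ ^ Module.finrank ℝ E * L₀.det := LinearMap.det_smul _ _
    have h := this (L₀ := ‖L₀‖⁻¹ • L₀) (by rw [hd]; exact mul_ne_zero (pow_pos hr _).ne' hL₀)
      (by rw [norm_smul, norm_inv, norm_norm, inv_mul_cancel₀ (inv_pos.1 hr).ne'])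
    rwa [functional_smul hB hsum hL₀ hr] at h
  have hC0 : 0 < C := (functional_pos hB c hL₀).trans_le (hC _ hL₀)
  have hgm : ∀ i, Measurable (g i) := fun i => (hg i).choose_spec.measurable
  have hg0 : ∀ i y, 0 ≤ g i y := fun i => (hg i).choose_spec.lower
  set δ : ℕ → ℝ := fun m => 1 / ((m : ℝ) + 1) with hδ
  have hδ0 : ∀ m, 0 < δ m := fun m => by positivity
  have hδl : Filter.Tendsto δ Filter.atTop (nhds 0) := tendsto_one_div_add_atTop_nhds_zero_nat
  have hexp : ∀ {b : ℝ} (i : ι), ContinuousAt (fun s : ℝ => b ^ (c i / (1 + s))) 0 := fun i =>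
    continuousAt_const.rpow (continuousAt_const.div (by fun_prop) (by norm_num))
      (Or.inr (by simpa using hc i))
  have hcont : ∀ x, ContinuousAt (fun s : ℝ => ENNReal.ofReal (Real.exp (-(s * ‖x‖ ^ 2) / 2) *
      ∏ i, g i (B i x) ^ (c i / (1 + s)))) 0 := fun x =>
    ENNReal.continuous_ofReal.continuousAt.comp
      ((by fun_prop : ContinuousAt (fun s : ℝ => Real.exp (-(s * ‖x‖ ^ 2) / 2)) 0).mul
        (tendsto_finsetProd _ fun i _ => hexp i))
  have hlim : ∀ x, Filter.Tendsto (fun m => ENNReal.ofReal (Real.exp (-(δ m * ‖x‖ ^ 2) / 2)) *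
        ∏ i, ENNReal.ofReal (g i (B i x)) ^ (c i / (1 + δ m))) Filter.atTop
      (nhds (∏ i, ENNReal.ofReal (g i (B i x)) ^ c i)) := fun x => by
    have h := (hcont x).tendsto.comp hδl
    have e : ∀ s : ℝ, 0 ≤ s → ENNReal.ofReal (Real.exp (-(s * ‖x‖ ^ 2) / 2) *
        ∏ i, g i (B i x) ^ (c i / (1 + s))) = ENNReal.ofReal (Real.exp (-(s * ‖x‖ ^ 2) / 2)) *
        ∏ i, ENNReal.ofReal (g i (B i x)) ^ (c i / (1 + s)) := fun s hs => by
      rw [ENNReal.ofReal_mul (by positivity), ENNReal.ofReal_prod_of_nonneg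
        fun i _ => Real.rpow_nonneg (hg0 _ _) _]
      congr 1
      refine Finset.prod_congr rfl fun i _ => ?_
      rw [ENNReal.ofReal_rpow_of_nonneg (hg0 _ _) (div_nonneg (hc i).le (by linarith))]
    rw [e 0 le_rfl] at h
    simp only [zero_mul, neg_zero, zero_div, Real.exp_zero, ENNReal.ofReal_one, one_mul, add_zero,
      div_one] at h
    refine h.congr fun m => ?_
    exact e _ (hδ0 m).le
  have hRlim : Filter.Tendsto (fun m => ENNReal.ofReal (lossFactor (Module.finrank ℝ E)
        (functional B c L₀ * |L₀.det| ^ δ m) C (δ m) * ∏ i, a i ^ (c i / (1 + δ m)))) Filter.atTop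
      (nhds (ENNReal.ofReal ((functional B c L₀ / C) ^ (-(Module.finrank ℝ E : ℝ)) * C *
        ∏ i, a i ^ c i))) := by
    refine ENNReal.tendsto_ofReal (Filter.Tendsto.mul ?_ ?_)
    · exact (tendsto_lossFactor _ (functional_pos hB c hL₀) (abs_pos.2 hL₀) hC0).comp hδl
    · refine tendsto_finsetProd _ fun i _ => ?_
      have h := (hexp (b := a i) i).tendsto.comp hδl
      simpa [Function.comp_def] using h
  calc ∫⁻ x, ∏ i, ENNReal.ofReal (g i (B i x)) ^ c i
      = ∫⁻ x, Filter.liminf (fun m => ENNReal.ofReal (Real.exp (-(δ m * ‖x‖ ^ 2) / 2)) *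
        ∏ i, ENNReal.ofReal (g i (B i x)) ^ (c i / (1 + δ m))) Filter.atTop :=
        lintegral_congr fun x => (hlim x).liminf_eq.symm
    _ ≤ Filter.liminf (fun m => ∫⁻ x, ENNReal.ofReal (Real.exp (-(δ m * ‖x‖ ^ 2) / 2)) *
        ∏ i, ENNReal.ofReal (g i (B i x)) ^ (c i / (1 + δ m))) Filter.atTop :=
        lintegral_liminf_le fun m => by fun_prop
    _ ≤ Filter.liminf (fun m => ENNReal.ofReal (lossFactor (Module.finrank ℝ E)
        (functional B c L₀ * |L₀.det| ^ δ m) C (δ m) * ∏ i, a i ^ (c i / (1 + δ m))))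
        Filter.atTop := by
        refine Filter.liminf_le_liminf (Filter.Eventually.of_forall fun m => ?_)
        refine (lintegral_exp_mul_prod_le_lossFactor hB hc hsum (hδ0 m) hC hL₀ hL₀' hg).trans_eq ?_
        rw [mul_comm (lossFactor _ _ _ _), ENNReal.ofReal_mul (Finset.prod_nonneg fun i _ =>
          Real.rpow_nonneg (ha i) _), mul_comm, ENNReal.ofReal_prod_of_nonneg
          fun i _ => Real.rpow_nonneg (ha i) _]
        congr 1
        refine Finset.prod_congr rfl fun i _ => ?_
        have := hδ0 m
        rw [hga, ENNReal.ofReal_rpow_of_nonneg (ha i) (div_nonneg (hc i).le (by linarith))]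
    _ = _ := hRlim.liminf_eq

theorem lintegral_prod_le_gaussianConst_of_isTame (hB : ∀ i, Function.Surjective (B i))
    (hc : ∀ i, 0 < c i)
    (hsum : ∑ i, c i * (Module.finrank ℝ (H i) : ℝ) = Module.finrank ℝ E)
    (hfin : gaussianConst B c ≠ ∞)
    {g : ∀ i, H i → ℝ} (hg : ∀ i, ∃ M, IsTame 0 M (g i))
    (hgi : ∀ i, ∫⁻ y, ENNReal.ofReal (g i y) ≠ ∞) :
    ∫⁻ x, ∏ i, ENNReal.ofReal (g i (B i x)) ^ c i ≤
      gaussianConst B c * ∏ i, (∫⁻ y, ENNReal.ofReal (g i y)) ^ c i := by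
  set S : Set ℝ := {v | ∃ L : E →L[ℝ] E, L.det ≠ 0 ∧ v = functional B c L} with hS
  have hbd : ∀ v ∈ S, v ≤ (gaussianConst B c).toReal := by
    rintro v ⟨L, hL, rfl⟩
    choose W hW using fun i => exists_isWhitening (surjective_comp (hB i) hL)
    have h := ofReal_le_gaussianConst hsum hL hW
    rw [← functional_eq_of_isWhitening c hW] at h
    exact (ENNReal.ofReal_le_iff_le_toReal hfin).1 h
  have hSb : BddAbove S := ⟨_, hbd⟩
  have hid : (ContinuousLinearMap.id ℝ E).det ≠ 0 := by
    rw [show (ContinuousLinearMap.id ℝ E).det = 1 from LinearMap.det_id]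
    exact one_ne_zero
  have hSn : S.Nonempty := ⟨_, _, hid, rfl⟩
  have hC : ∀ L, L.det ≠ 0 → functional B c L ≤ sSup S := fun L hL => le_csSup hSb ⟨L, hL, rfl⟩
  have hC0 : 0 < sSup S := (functional_pos hB c hid).trans_le (hC _ hid)
  set a := fun i => (∫⁻ y, ENNReal.ofReal (g i y)).toReal with ha
  have hga : ∀ i, ∫⁻ y, ENNReal.ofReal (g i y) = ENNReal.ofReal (a i) := fun i =>
    (ENNReal.ofReal_toReal (hgi i)).symm
  have ha0 : ∀ i, 0 ≤ a i := fun i => ENNReal.toReal_nonneg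
  obtain ⟨v, -, hv, hvS⟩ := exists_seq_tendsto_sSup hSn hSb
  have hlim : Filter.Tendsto (fun m => ENNReal.ofReal ((v m / sSup S) ^
      (-(Module.finrank ℝ E : ℝ)) * sSup S * ∏ i, a i ^ c i)) Filter.atTop
      (nhds (ENNReal.ofReal (sSup S * ∏ i, a i ^ c i))) := by
    refine ENNReal.tendsto_ofReal (Filter.Tendsto.mul_const _ ?_)
    have h1 : Filter.Tendsto (fun m => v m / sSup S) Filter.atTop (nhds 1) := by
      simpa [hC0.ne'] using hv.div_const (sSup S)
    simpa using (h1.rpow_const (p := -(Module.finrank ℝ E : ℝ))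
      (Or.inl one_ne_zero)).mul_const (sSup S)
  have h := ge_of_tendsto' hlim fun m => by
    obtain ⟨L, hL, hvL⟩ := hvS m
    rw [hvL]
    exact lintegral_prod_le_of_functional_le hB hc hsum hC hL hg ha0 hga
  refine h.trans ?_
  rw [ENNReal.ofReal_mul hC0.le, ENNReal.ofReal_prod_of_nonneg
    fun i _ => Real.rpow_nonneg (ha0 i) _]
  refine mul_le_mul' (ENNReal.ofReal_le_of_le_toReal (csSup_le hSn hbd)) (le_of_eq ?_)
  refine Finset.prod_congr rfl fun i _ => ?_
  rw [hga, ENNReal.ofReal_rpow_of_nonneg (ha0 i) (hc i).le]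

theorem lintegral_prod_le_gaussianConst (hB : ∀ i, Function.Surjective (B i))
    (hc : ∀ i, 0 < c i)
    (hsum : ∑ i, c i * (Module.finrank ℝ (H i) : ℝ) = Module.finrank ℝ E)
    {f : ∀ i, H i → ℝ} (hf0 : ∀ i y, 0 ≤ f i y) (hf : ∀ i, Integrable (f i)) :
    ∫⁻ x, ∏ i, ENNReal.ofReal (f i (B i x)) ^ c i ≤
      gaussianConst B c * ∏ i, (∫⁻ y, ENNReal.ofReal (f i y)) ^ c i := by
  have hqmp : ∀ i, Measure.QuasiMeasurePreserving (B i) volume volume := fun i => by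
    obtain ⟨r, -, hr⟩ := LinearMap.exists_map_addHaar_eq_smul_addHaar (L := (B i).toLinearMap)
      volume volume (hB i)
    refine ⟨(B i).measurable, ?_⟩
    rw [show Measure.map (B i) volume = r • volume from hr]
    exact Measure.smul_absolutelyContinuous
  have hfi : ∀ i, ∫⁻ y, ENNReal.ofReal (f i y) = ENNReal.ofReal (∫ y, f i y) := fun i =>
    (ofReal_integral_eq_lintegral_ofReal (hf i) (Filter.Eventually.of_forall (hf0 i))).symm
  rcases eq_or_ne (gaussianConst B c) ∞ with htop | hfin
  · by_cases h0 : ∃ i, ∫⁻ y, ENNReal.ofReal (f i y) = 0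
    · obtain ⟨i, hi⟩ := h0
      rw [lintegral_eq_zero_iff' (hf i).1.aemeasurable.ennreal_ofReal] at hi
      have h := (hqmp i).ae hi
      refine le_trans (le_of_eq ?_) zero_le
      rw [← lintegral_zero]
      refine lintegral_congr_ae ?_
      filter_upwards [h] with x hx
      refine Finset.prod_eq_zero (Finset.mem_univ i) ?_
      rw [show ENNReal.ofReal (f i (B i x)) = 0 from hx, ENNReal.zero_rpow_of_pos (hc i)]
    · push Not at h0
      rw [htop, ENNReal.top_mul]
      · exact le_top
      · refine Finset.prod_ne_zero_iff.2 fun i _ => ?_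
        exact (ENNReal.rpow_pos (pos_iff_ne_zero.2 (h0 i)) (by rw [hfi]; exact
          ENNReal.ofReal_ne_top)).ne'
  choose g hg hgint hgeq hglim using fun i => exists_isTame_seq (hf i) (hf0 i)
  have hgm : ∀ i m, Measurable (g i m) := fun i m => (hg i m).choose_spec.measurable
  have hg0 : ∀ i m y, 0 ≤ g i m y := fun i m => (hg i m).choose_spec.lower
  have hgi : ∀ i m, ∫⁻ y, ENNReal.ofReal (g i m y) = ∫⁻ y, ENNReal.ofReal (f i y) := fun i m => by
    rw [hfi, ← hgeq i m]
    exact (ofReal_integral_eq_lintegral_ofReal (hgint i m)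
      (Filter.Eventually.of_forall (hg0 i m))).symm
  have hlim : ∀ᵐ x, Filter.Tendsto (fun m => ∏ i, ENNReal.ofReal (g i m (B i x)) ^ c i)
      Filter.atTop (nhds (∏ i, ENNReal.ofReal (f i (B i x)) ^ c i)) := by
    filter_upwards [ae_all_iff.2 fun i => (hqmp i).ae (hglim i)] with x hx
    have h : Filter.Tendsto (fun m => ENNReal.ofReal (∏ i, g i m (B i x) ^ c i))
        Filter.atTop (nhds (ENNReal.ofReal (∏ i, f i (B i x) ^ c i))) :=
      ENNReal.tendsto_ofReal (tendsto_finsetProd _ fun i _ =>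
        (hx i).rpow_const (Or.inr (hc i).le))
    have e : ∀ b : ι → ℝ, (∀ i, 0 ≤ b i) → ENNReal.ofReal (∏ i, b i ^ c i) =
        ∏ i, ENNReal.ofReal (b i) ^ c i := fun b hb => by
      rw [ENNReal.ofReal_prod_of_nonneg fun i _ => Real.rpow_nonneg (hb i) _]
      exact Finset.prod_congr rfl fun i _ =>
        (ENNReal.ofReal_rpow_of_nonneg (hb i) (hc i).le).symm
    rw [e _ fun i => hf0 i _] at h
    exact h.congr fun m => e _ fun i => hg0 i m _
  calc ∫⁻ x, ∏ i, ENNReal.ofReal (f i (B i x)) ^ c i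
      = ∫⁻ x, Filter.liminf (fun m => ∏ i, ENNReal.ofReal (g i m (B i x)) ^ c i) Filter.atTop :=
        lintegral_congr_ae (hlim.mono fun x hx => hx.liminf_eq.symm)
    _ ≤ Filter.liminf (fun m => ∫⁻ x, ∏ i, ENNReal.ofReal (g i m (B i x)) ^ c i) Filter.atTop :=
        lintegral_liminf_le fun m => by fun_prop
    _ ≤ Filter.liminf (fun _ : ℕ => gaussianConst B c *
        ∏ i, (∫⁻ y, ENNReal.ofReal (f i y)) ^ c i) Filter.atTop := by
        refine Filter.liminf_le_liminf (Filter.Eventually.of_forall fun m => ?_)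
        refine (lintegral_prod_le_gaussianConst_of_isTame hB hc hsum hfin
          (fun i => hg i m) fun i => ?_).trans_eq ?_
        · rw [hgi, hfi]; exact ENNReal.ofReal_ne_top
        · simp only [hgi]
    _ = _ := Filter.liminf_const _

end Main

end BrascampLieb

/-- The general Brascamp--Lieb inequality (Brascamp--Lieb, Lieb): for a Brascamp--Lieb
datum given by surjective linear maps `Bᵢ : ℝⁿ → Hᵢ` onto `nᵢ`-dimensional Euclidean
spaces and `cᵢ > 0` with `∑ᵢ cᵢnᵢ = n`, and for non-negative `fᵢ ∈ L¹(Hᵢ)`,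
`∫_{ℝⁿ} ∏ᵢ fᵢ(Bᵢx)^{cᵢ} dx ≤ C ∏ᵢ (∫_{Hᵢ} fᵢ)^{cᵢ}`, where `C` is the supremum of the
corresponding ratios over all centered Gaussian inputs `fᵢ(x) = e^{-⟪Aᵢx, x⟫}` with
`Aᵢ` positive definite. -/
theorem general_brascamp_lieb
    {n k : ℕ} (H : Fin k → Type*)
    [∀ i, NormedAddCommGroup (H i)] [∀ i, InnerProductSpace ℝ (H i)]
    [∀ i, FiniteDimensional ℝ (H i)] [∀ i, MeasurableSpace (H i)] [∀ i, BorelSpace (H i)]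
    (hH : ∀ i, 1 ≤ Module.finrank ℝ (H i))
    (B : ∀ i, EuclideanSpace ℝ (Fin n) →ₗ[ℝ] H i)
    (hB : ∀ i, Function.Surjective (B i))
    (c : Fin k → ℝ) (hc : ∀ i, 0 < c i)
    (hsum : ∑ i, c i * (Module.finrank ℝ (H i) : ℝ) = (n : ℝ))
    (f : ∀ i, H i → ℝ) (hf0 : ∀ i x, 0 ≤ f i x) (hf : ∀ i, Integrable (f i)) :
    ∫⁻ x, ∏ i, ENNReal.ofReal (f i (B i x)) ^ (c i) ≤
      (⨆ (A : ∀ i, H i →ₗ[ℝ] H i) (_ : ∀ i, IsPosDefMap (A i)),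
        (∫⁻ x, ∏ i, ENNReal.ofReal (Real.exp (-⟪A i (B i x), B i x⟫)) ^ (c i)) /
          ∏ i, (∫⁻ y, ENNReal.ofReal (Real.exp (-⟪A i y, y⟫))) ^ (c i)) *
        ∏ i, (∫⁻ y, ENNReal.ofReal (f i y)) ^ (c i) := by
  exact BrascampLieb.lintegral_prod_le_gaussianConst
    (B := fun i => LinearMap.toContinuousLinearMap (B i)) hB hc
    (by rw [hsum, finrank_euclideanSpace_fin]) hf0 hf
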